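/- Let (H,R) be a finite-dimensional semisimple and cosemisimple quasi-triangular Hopf algebra over a field k and let D be a minimal H-adjoint-stable subcoalgebra of H_R. Then the category _H^D M of left H-modules that are left D-comodules with compatibility ρ_R(hv) = Σ h₍₁₎·_ad v⁽⁻¹⁾ ⊗ h₍₂₎v⁽⁰⁾ is an indecomposable module category over the tensor category _{H^cop}M of left H^cop-modules, where X ⊗ V carries the H-action h(x⊗v) = Σ h₍₂₎x ⊗ h₍₁₎v and the D-coaction on the factor V. -/

import Mathlib

open TensorProduct LinearMap

variable (K : Type) [Field K] (H : Type) [Ring H] [HopfAlgebra K H]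

/-- The left adjoint action as a linear map `H ⊗ H →ₗ H`, `h ⊗ a ↦ Σ h₍₁₎ * a * S(h₍₂₎)`. -/
noncomputable def adMap : H ⊗[K] H →ₗ[K] H :=
  (LinearMap.mul' K H) ∘ₗ
    (LinearMap.lTensor H ((LinearMap.mul' K H) ∘ₗ
      (LinearMap.lTensor H (HopfAlgebra.antipode (R := K))) ∘ₗ
      (TensorProduct.comm K H H).toLinearMap)) ∘ₗ
    (TensorProduct.assoc K H H H).toLinearMap ∘ₗ
    (LinearMap.rTensor H (Coalgebra.comul (R := K)))

/-- `h ·_ad a = Σ h₍₁₎ a S(h₍₂₎)`. -/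
noncomputable def adAct (h a : H) : H := adMap K H (h ⊗ₜ a)

/-- `R¹² = Σ r¹ ⊗ r² ⊗ 1` in `H ⊗ (H ⊗ H)`. -/
noncomputable def r12 (R : H ⊗[K] H) : H ⊗[K] (H ⊗[K] H) :=
  TensorProduct.map LinearMap.id ((TensorProduct.mk K H H).flip 1) R

/-- `R¹³ = Σ r¹ ⊗ 1 ⊗ r²` in `H ⊗ (H ⊗ H)`. -/
noncomputable def r13 (R : H ⊗[K] H) : H ⊗[K] (H ⊗[K] H) :=
  TensorProduct.map LinearMap.id (TensorProduct.mk K H H 1) R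

/-- `R²³ = 1 ⊗ R` in `H ⊗ (H ⊗ H)`. -/
noncomputable def r23 (R : H ⊗[K] H) : H ⊗[K] (H ⊗[K] H) := (1 : H) ⊗ₜ R

/-- `(H,R)` is a quasi-triangular Hopf algebra: `R` is invertible,
`R Δ(h) = Δᶜᵒᵖ(h) R`, `(Δ⊗id)(R) = R¹³R²³` and `(id⊗Δ)(R) = R¹³R¹²`. -/
structure IsQuasiTriangular (R : H ⊗[K] H) : Prop where
  isUnit : IsUnit R
  intertwine : ∀ h : H, R * Coalgebra.comul h =
    (TensorProduct.comm K H H) (Coalgebra.comul h) * R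
  comul_rTensor : (TensorProduct.assoc K H H H)
      ((LinearMap.rTensor H (Coalgebra.comul (R := K))) R) = r13 K H R * r23 K H R
  comul_lTensor : (LinearMap.lTensor H (Coalgebra.comul (R := K))) R = r13 K H R * r12 K H R

/-- The comultiplication `Δ_R` of the transmuted braided group `H_R`:
`Δ_R(h) = Σ h₍₁₎ S(R²) ⊗ R¹ ·_ad h₍₂₎`. -/
noncomputable def deltaR (R : H ⊗[K] H) : H →ₗ[K] H ⊗[K] H :=
  (TensorProduct.map
      ((LinearMap.mul' K H) ∘ₗ (LinearMap.lTensor H (HopfAlgebra.antipode (R := K))))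
      ((adMap K H) ∘ₗ (TensorProduct.comm K H H).toLinearMap)) ∘ₗ
    (TensorProduct.tensorTensorTensorComm K H H H H).toLinearMap ∘ₗ
    (LinearMap.lTensor (H ⊗[K] H) (TensorProduct.comm K H H).toLinearMap) ∘ₗ
    ((TensorProduct.mk K (H ⊗[K] H) (H ⊗[K] H)).flip R) ∘ₗ
    (Coalgebra.comul (R := K))

/-- A subcoalgebra of `(H, Δ)`. -/
def IsSubcoalgebra (D : Submodule K H) : Prop :=
  ∀ a ∈ D, Coalgebra.comul (R := K) a ∈ Submodule.map₂ (TensorProduct.mk K H H) D D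

/-- A simple (nonzero, minimal) subcoalgebra of `(H, Δ)`. -/
def IsSimpleSubcoalgebra (D : Submodule K H) : Prop :=
  D ≠ ⊥ ∧ IsSubcoalgebra K H D ∧
    ∀ D' : Submodule K H, D' ≤ D → IsSubcoalgebra K H D' → D' = ⊥ ∨ D' = D

/-- `H` is a cosemisimple coalgebra: the sum of its simple subcoalgebras is everything. -/
def IsCosemisimpleCoalgebra : Prop :=
  sSup {D : Submodule K H | IsSimpleSubcoalgebra K H D} = ⊤

/-- A subcoalgebra of the transmuted braided group `(H, Δ_R)`. -/
def IsSubcoalgebraR (R : H ⊗[K] H) (D : Submodule K H) : Prop :=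
  ∀ a ∈ D, deltaR K H R a ∈ Submodule.map₂ (TensorProduct.mk K H H) D D

/-- A simple (nonzero, minimal) subcoalgebra of `(H, Δ_R)`. -/
def IsSimpleSubcoalgebraR (R : H ⊗[K] H) (D : Submodule K H) : Prop :=
  D ≠ ⊥ ∧ IsSubcoalgebraR K H R D ∧
    ∀ D' : Submodule K H, D' ≤ D → IsSubcoalgebraR K H R D' → D' = ⊥ ∨ D' = D

/-- The coalgebra `(H, Δ_R)` is cosemisimple: it is the sum of its simple subcoalgebras. -/
def IsCosemisimpleR (R : H ⊗[K] H) : Prop :=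
  sSup {D : Submodule K H | IsSimpleSubcoalgebraR K H R D} = ⊤

/-- A Yetter–Drinfeld submodule of `H` (with the adjoint action and the coproduct):
a subspace stable under `·_ad` and a left subcomodule for `Δ`, i.e. `Δ(D) ⊆ H ⊗ D`. -/
def IsYDSubmodule (D : Submodule K H) : Prop :=
  (∀ (h : H), ∀ a ∈ D, adAct K H h a ∈ D) ∧
  (∀ a ∈ D, Coalgebra.comul (R := K) a ∈ Submodule.map₂ (TensorProduct.mk K H H) ⊤ D)

/-- A minimal (irreducible) Yetter–Drinfeld submodule of `H`. -/
def IsMinimalYDSubmodule (D : Submodule K H) : Prop :=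
  D ≠ ⊥ ∧ IsYDSubmodule K H D ∧
    ∀ D' : Submodule K H, D' ≤ D → IsYDSubmodule K H D' → D' = ⊥ ∨ D' = D

/-- An `H`-adjoint-stable subcoalgebra of the transmuted braided group `H_R`:
a subcoalgebra of `(H, Δ_R)` which is stable under the left adjoint action. -/
def IsAdjointStableSubcoalgebra (R : H ⊗[K] H) (D : Submodule K H) : Prop :=
  (∀ (h : H), ∀ a ∈ D, adAct K H h a ∈ D) ∧
  (∀ a ∈ D, deltaR K H R a ∈ Submodule.map₂ (TensorProduct.mk K H H) D D)

/-- A minimal (nonzero) `H`-adjoint-stable subcoalgebra of `H_R`. -/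
def IsMinimalAdjointStableSubcoalgebra (R : H ⊗[K] H) (D : Submodule K H) : Prop :=
  D ≠ ⊥ ∧ IsAdjointStableSubcoalgebra K H R D ∧
    ∀ D' : Submodule K H, D' ≤ D → IsAdjointStableSubcoalgebra K H R D' → D' = ⊥ ∨ D' = D

/-- An object of `_H^{H_R}M`: a left `H`-module `V` together with a left comodule
structure `ρ_R` over the transmuted braided group `(H, Δ_R)`, satisfying the
compatibility `ρ_R(hv) = Σ h₍₁₎ ·_ad v⁽⁻¹⁾ ⊗ h₍₂₎ v⁽⁰⁾`.  By Zhu's lemma, this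
category is the Yetter–Drinfeld category `_H^H YD`. -/
structure RModStr (R : H ⊗[K] H) (V : Type*) [AddCommGroup V] [Module K V] where
  act : H →ₐ[K] Module.End K V
  coact : V →ₗ[K] H ⊗[K] V
  counit_coact : ∀ v : V,
    (TensorProduct.lid K V)
      ((LinearMap.rTensor V (Coalgebra.counit (R := K))) (coact v)) = v
  coassocR : (LinearMap.rTensor V (deltaR K H R)) ∘ₗ coact
      = (TensorProduct.assoc K H H V).symm.toLinearMap ∘ₗ
        (LinearMap.lTensor H coact) ∘ₗ coact
  compat : coact ∘ₗ (TensorProduct.lift act.toLinearMap)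
      = (TensorProduct.map (adMap K H) (TensorProduct.lift act.toLinearMap)) ∘ₗ
        (TensorProduct.tensorTensorTensorComm K H H H V).toLinearMap ∘ₗ
        (TensorProduct.map (Coalgebra.comul (R := K)) coact)

/-- The object lies in the subcategory `_H^D M`: its coaction takes values in `D ⊗ V`. -/
def memDCat (R : H ⊗[K] H) (D : Submodule K H) {V : Type*} [AddCommGroup V]
    [Module K V] (s : RModStr K H R V) : Prop :=
  ∀ v : V, s.coact v ∈ Submodule.map₂ (TensorProduct.mk K H V) D ⊤

/-- Irreducibility of an object of `_H^{H_R}M = _H^H YD`: it is nonzero and has no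
nontrivial subspace stable under the action and the coaction. -/
def RModIrreducible (R : H ⊗[K] H) {V : Type*} [AddCommGroup V] [Module K V]
    (s : RModStr K H R V) : Prop :=
  (⊥ : Submodule K V) ≠ ⊤ ∧
    ∀ W : Submodule K V, (∀ h : H, ∀ w ∈ W, s.act h w ∈ W) →
      (∀ w ∈ W, s.coact w ∈ Submodule.map₂ (TensorProduct.mk K H V) ⊤ W) →
      W = ⊥ ∨ W = ⊤

/-- A left comodule structure over a subcoalgebra `D` of the transmuted braided
group `(H, Δ_R)`. -/
structure DComodStr (R : H ⊗[K] H) (D : Submodule K H) (W : Type*) [AddCommGroup W]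
    [Module K W] where
  coact : W →ₗ[K] H ⊗[K] W
  mem : ∀ w : W, coact w ∈ Submodule.map₂ (TensorProduct.mk K H W) D ⊤
  counit_coact : ∀ w : W,
    (TensorProduct.lid K W)
      ((LinearMap.rTensor W (Coalgebra.counit (R := K))) (coact w)) = w
  coassocR : (LinearMap.rTensor W (deltaR K H R)) ∘ₗ coact
      = (TensorProduct.assoc K H H W).symm.toLinearMap ∘ₗ
        (LinearMap.lTensor H coact) ∘ₗ coact

/-- The coaction `ρ_R(h ⊗ w) = Σ h₍₁₎ ·_ad w₍₋₁₎ ⊗ (h₍₂₎ ⊗ w₍₀₎)` on `H ⊗ W`. -/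
noncomputable def rhoHW (R : H ⊗[K] H) {D : Submodule K H} {W : Type*} [AddCommGroup W]
    [Module K W] (sW : DComodStr K H R D W) :
    H ⊗[K] W →ₗ[K] H ⊗[K] (H ⊗[K] W) :=
  (TensorProduct.map (adMap K H) LinearMap.id) ∘ₗ
    (TensorProduct.tensorTensorTensorComm K H H H W).toLinearMap ∘ₗ
    (TensorProduct.map (Coalgebra.comul (R := K)) sW.coact)

/-- The cotensor product `X □ Y ⊆ X ⊗ Y` of a right `H`-comodule `(X, ρX)` and a left
`H`-comodule `(Y, ρY)`. -/
noncomputable def cotensor {X Y : Type*} [AddCommGroup X] [Module K X] [AddCommGroup Y]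
    [Module K Y] (ρX : X →ₗ[K] X ⊗[K] H) (ρY : Y →ₗ[K] H ⊗[K] Y) :
    Submodule K (X ⊗[K] Y) :=
  LinearMap.ker ((TensorProduct.assoc K X H Y).toLinearMap ∘ₗ
    (LinearMap.rTensor Y ρX) - (LinearMap.lTensor X ρY))

/-- `ρ*` is the right comodule structure on `W*` dual to the left comodule structure
`coactW` on `W`:  `Σ ⟨f⁽⁰⁾, w⟩ f⁽¹⁾ = Σ w₍₋₁₎ ⟨f, w₍₀₎⟩`. -/
def IsDualCoaction {W : Type*} [AddCommGroup W] [Module K W]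
    (coactW : W →ₗ[K] H ⊗[K] W)
    (ρstar : Module.Dual K W →ₗ[K] (Module.Dual K W) ⊗[K] H) : Prop :=
  ∀ (f : Module.Dual K W) (w : W),
    (TensorProduct.lid K H) ((LinearMap.rTensor H ((Module.Dual.eval K W) w)) (ρstar f))
      = (TensorProduct.rid K H) ((LinearMap.lTensor H f) (coactW w))

/-- The space `Hom_H^D(V₁, V₂)` of maps which are simultaneously left `H`-module and
left comodule morphisms. -/
def homHD (R : H ⊗[K] H) {V₁ V₂ : Type*} [AddCommGroup V₁] [Module K V₁]
    [AddCommGroup V₂] [Module K V₂] (s : RModStr K H R V₁) (t : RModStr K H R V₂) :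
    Submodule K (V₁ →ₗ[K] V₂) where
  carrier := {f | (∀ h : H, (t.act h : V₂ →ₗ[K] V₂) ∘ₗ f = f ∘ₗ (s.act h : V₁ →ₗ[K] V₁)) ∧
    (LinearMap.lTensor H f) ∘ₗ s.coact = t.coact ∘ₗ f}
  add_mem' := by
    rintro f g ⟨hf1, hf2⟩ ⟨hg1, hg2⟩
    refine ⟨fun h => ?_, ?_⟩
    · rw [LinearMap.comp_add, LinearMap.add_comp, hf1 h, hg1 h]
    · rw [LinearMap.lTensor_add, LinearMap.add_comp, LinearMap.comp_add, hf2, hg2]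
  zero_mem' := by
    refine ⟨fun h => ?_, ?_⟩ <;> simp
  smul_mem' := by
    rintro c f ⟨hf1, hf2⟩
    refine ⟨fun h => ?_, ?_⟩
    · rw [LinearMap.comp_smul, LinearMap.smul_comp, hf1 h]
    · rw [LinearMap.lTensor_smul, LinearMap.smul_comp, LinearMap.comp_smul, hf2]

/-- The algebra `Hom_H^D(V, V)` of endomorphisms of `V` which are simultaneously left
`H`-module and left comodule morphisms. -/
def endHD (R : H ⊗[K] H) {V : Type*} [AddCommGroup V] [Module K V]
    (s : RModStr K H R V) : Subalgebra K (Module.End K V) where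
  carrier := {f | (∀ h : H, (s.act h : V →ₗ[K] V) ∘ₗ f = f ∘ₗ (s.act h : V →ₗ[K] V)) ∧
    (LinearMap.lTensor H f) ∘ₗ s.coact = s.coact ∘ₗ f}
  add_mem' := by
    rintro f g ⟨hf1, hf2⟩ ⟨hg1, hg2⟩
    refine ⟨fun h => ?_, ?_⟩
    · rw [LinearMap.comp_add, LinearMap.add_comp, hf1 h, hg1 h]
    · rw [LinearMap.lTensor_add, LinearMap.add_comp, LinearMap.comp_add, hf2, hg2]
  mul_mem' := by
    rintro f g ⟨hf1, hf2⟩ ⟨hg1, hg2⟩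
    refine ⟨fun h => ?_, ?_⟩
    · show (s.act h : V →ₗ[K] V) ∘ₗ (f ∘ₗ g) = (f ∘ₗ g) ∘ₗ (s.act h : V →ₗ[K] V)
      rw [← LinearMap.comp_assoc, hf1 h, LinearMap.comp_assoc, hg1 h, LinearMap.comp_assoc]
    · show (LinearMap.lTensor H (f ∘ₗ g)) ∘ₗ s.coact = s.coact ∘ₗ (f ∘ₗ g)
      rw [LinearMap.lTensor_comp, LinearMap.comp_assoc, hg2, ← LinearMap.comp_assoc, hf2,
        LinearMap.comp_assoc]
  algebraMap_mem' := by
    intro c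
    refine ⟨fun h => ?_, ?_⟩
    · ext v
      simp [Module.algebraMap_end_apply]
    · ext v
      have : ((algebraMap K (Module.End K V)) c) = c • (LinearMap.id (M := V)) := by
        ext w; simp [Module.algebraMap_end_apply]
      simp [this, Module.algebraMap_end_apply]

/-- The `H^cop`-action `h · (x ⊗ v) = Σ h₍₂₎ x ⊗ h₍₁₎ v` on `X ⊗ V`. -/
noncomputable def actCop {X V : Type} [AddCommGroup X] [Module K X] [AddCommGroup V]
    [Module K V] (ξ : H →ₐ[K] Module.End K X) (α : H →ₐ[K] Module.End K V) (h : H) :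
    X ⊗[K] V →ₗ[K] X ⊗[K] V :=
  (TensorProduct.map (TensorProduct.lift ξ.toLinearMap)
      (TensorProduct.lift α.toLinearMap)) ∘ₗ
    (TensorProduct.tensorTensorTensorComm K H H X V).toLinearMap ∘ₗ
    ((TensorProduct.mk K (H ⊗[K] H) (X ⊗[K] V))
      ((TensorProduct.comm K H H) (Coalgebra.comul (R := K) h)))

/-- The coaction on `X ⊗ V` coming from the coaction on the right tensorand `V`. -/
noncomputable def coactXV {X V : Type} [AddCommGroup X] [Module K X] [AddCommGroup V]
    [Module K V] (coact : V →ₗ[K] H ⊗[K] V) : X ⊗[K] V →ₗ[K] H ⊗[K] (X ⊗[K] V) :=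
  (TensorProduct.assoc K H X V).toLinearMap ∘ₗ
    (LinearMap.rTensor V (TensorProduct.comm K X H).toLinearMap) ∘ₗ
    (TensorProduct.assoc K X H V).symm.toLinearMap ∘ₗ
    (LinearMap.lTensor X coact)

namespace HopfAux

open Coalgebra HopfAlgebra WithConv

variable {K H} {A : Type*} [Ring A] [Algebra K A]

/-- The convolution product of two linear maps from a coalgebra to an algebra. -/
noncomputable def conv (f g : H →ₗ[K] A) : H →ₗ[K] A :=
  LinearMap.mul' K A ∘ₗ TensorProduct.map f g ∘ₗ Coalgebra.comul

/-- The linear map `h ↦ ε(h) a`. -/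
noncomputable def counitSMul (a : A) : H →ₗ[K] A :=
  (Coalgebra.counit (R := K) (A := H)).smulRight a

@[simp] lemma counitSMul_apply (a : A) (h : H) :
    counitSMul (K := K) a h = Coalgebra.counit (R := K) h • a := rfl

lemma conv_apply_repr {ι : Type*} (f g : H →ₗ[K] A) {h : H} (r : Repr K h ι) :
    conv f g h = ∑ i ∈ r.index, f (r.left i) * g (r.right i) := by
  simp [conv, ← r.eq, map_sum]

lemma conv_assoc (f g k : H →ₗ[K] A) : conv (conv f g) k = conv f (conv g k) :=
  congrArg WithConv.ofConv (mul_assoc (toConv f) (toConv g) (toConv k))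

lemma conv_counitSMul (f : H →ₗ[K] A) (a : A) :
    conv f (counitSMul a) = LinearMap.mulRight K a ∘ₗ f := by
  ext h
  rw [conv_apply_repr f _ (ℛ K h)]
  have h2 := congrArg (fun z => f (TensorProduct.rid K H z)) (Coalgebra.sum_tmul_counit_eq (ℛ K h))
  simp only [map_sum, TensorProduct.rid_tmul, map_smul, one_smul] at h2
  simp [← h2]

lemma counitSMul_conv (f : H →ₗ[K] A) (a : A) :
    conv (counitSMul a) f = LinearMap.mulLeft K a ∘ₗ f := by
  ext h
  rw [conv_apply_repr _ f (ℛ K h)]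
  have h2 := congrArg f (Coalgebra.sum_counit_smul (ℛ K h))
  simp only [map_sum, map_smul] at h2
  simp [← h2]

lemma counitSMul_one_conv (f : H →ₗ[K] A) : conv (counitSMul 1) f = f := by
  rw [counitSMul_conv]; ext; simp

lemma conv_counitSMul_one (f : H →ₗ[K] A) : conv f (counitSMul 1) = f := by
  rw [conv_counitSMul]; ext; simp

lemma counitSMul_conv_counitSMul (a b : A) :
    conv (counitSMul a) (counitSMul b) = counitSMul (K := K) (H := H) (a * b) := by
  rw [counitSMul_conv]; ext; simp

lemma algHom_comp_antipode_conv (F : H →ₐ[K] A) :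
    conv (F.toLinearMap ∘ₗ antipode K) F.toLinearMap = counitSMul 1 := by
  ext h
  rw [conv_apply_repr _ _ (ℛ K h)]
  have := congrArg F (sum_antipode_mul_eq_smul (ℛ K h))
  simpa [map_sum] using this

lemma algHom_conv_comp_antipode (F : H →ₐ[K] A) :
    conv F.toLinearMap (F.toLinearMap ∘ₗ antipode K) = counitSMul 1 := by
  ext h
  rw [conv_apply_repr _ _ (ℛ K h)]
  have := congrArg F (sum_mul_antipode_eq_smul (ℛ K h))
  simpa [map_sum] using this

lemma antipode_conv_id : conv (antipode K) LinearMap.id = counitSMul (K := K) (1 : H) :=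
  algHom_comp_antipode_conv (AlgHom.id K H)

/-- The adjoint action as a curried linear map. -/
noncomputable def ad : H →ₗ[K] H →ₗ[K] H := TensorProduct.curry (adMap K H)

lemma adMap_tmul (h a : H) : adMap K H (h ⊗ₜ a) = ad (K := K) h a := rfl

lemma ad_apply_repr {ι : Type*} {h : H} (r : Repr K h ι) (a : H) :
    ad (K := K) h a = ∑ i ∈ r.index, r.left i * a * antipode K (r.right i) := by
  simp [ad, adMap, ← r.eq, TensorProduct.sum_tmul, map_sum, mul_assoc]

lemma ad_flip_eq_conv (a : H) :
    (ad (K := K)).flip a = conv (conv LinearMap.id (counitSMul a)) (antipode K) := by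
  ext h
  rw [conv_apply_repr _ _ (ℛ K h), conv_counitSMul, LinearMap.flip_apply, ad_apply_repr (ℛ K h)]
  simp

lemma ad_mul_apply (g h a : H) : ad (K := K) (g * h) a = ad (K := K) g (ad (K := K) h a) := by
  have e : Coalgebra.comul (R := K) (g * h) = ∑ i ∈ (ℛ K g).index, ∑ j ∈ (ℛ K h).index,
      ((ℛ K g).left i * (ℛ K h).left j) ⊗ₜ[K] ((ℛ K g).right i * (ℛ K h).right j) := by
    rw [Bialgebra.comul_mul, ← (ℛ K g).eq, ← (ℛ K h).eq, Finset.sum_mul_sum]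
    simp
  have : ad (K := K) (g * h) a = ∑ i ∈ (ℛ K g).index, ∑ j ∈ (ℛ K h).index,
      ((ℛ K g).left i * (ℛ K h).left j) * a * antipode K ((ℛ K g).right i * (ℛ K h).right j) := by
    simp only [ad, TensorProduct.curry_apply, adMap, LinearMap.comp_apply, LinearMap.rTensor_tmul,
      e, TensorProduct.sum_tmul, map_sum]
    simp [mul_assoc]
  rw [this, ad_apply_repr (ℛ K g), ad_apply_repr (ℛ K h)]
  simp [Finset.mul_sum, Finset.sum_mul, antipode_mul_antidistrib, mul_assoc]

lemma ad_one_apply (a : H) : ad (K := K) (1 : H) a = a := by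
  simp [ad, adMap, Algebra.TensorProduct.one_def]

lemma ad_apply_mul (p q : H) :
    (ad (K := K)).flip (p * q) = conv ((ad (K := K)).flip p) ((ad (K := K)).flip q) := by
  simp only [ad_flip_eq_conv, conv_assoc]
  rw [← conv_assoc (antipode K) LinearMap.id, antipode_conv_id, counitSMul_one_conv,
    ← conv_assoc (counitSMul p), counitSMul_conv_counitSMul]

end HopfAux

namespace HopfAux

open Coalgebra HopfAlgebra

section Slices

variable {K : Type*} [Field K] {M N : Type*} [AddCommGroup M] [Module K M] [AddCommGroup N] [Module K N]

/-- The slice map `m ⊗ n ↦ f(n) m`. -/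
noncomputable def sliceR (f : N →ₗ[K] K) : M ⊗[K] N →ₗ[K] M :=
  (TensorProduct.rid K M).toLinearMap ∘ₗ LinearMap.lTensor M f

/-- The slice map `m ⊗ n ↦ f(m) n`. -/
noncomputable def sliceL (f : M →ₗ[K] K) : M ⊗[K] N →ₗ[K] N :=
  (TensorProduct.lid K N).toLinearMap ∘ₗ LinearMap.rTensor N f

@[simp] lemma sliceR_tmul (f : N →ₗ[K] K) (m : M) (n : N) : sliceR f (m ⊗ₜ[K] n) = f n • m := by
  simp [sliceR]

@[simp] lemma sliceL_tmul (f : M →ₗ[K] K) (m : M) (n : N) : sliceL f (m ⊗ₜ[K] n) = f m • n := by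
  simp [sliceL]

lemma eq_of_sliceR_eq {y z : M ⊗[K] N} (h : ∀ f : N →ₗ[K] K, sliceR f y = sliceR f z) : y = z := by
  classical
  let b := Module.Basis.ofVectorSpace K N
  have key : ∀ (y : M ⊗[K] N) i, TensorProduct.equivFinsuppOfBasisRight b y i
      = sliceR (b.coord i) y := by
    intro y i
    induction y with
    | zero => simp
    | add a c ha hc => simp [ha, hc]
    | tmul m n => simp
  apply (TensorProduct.equivFinsuppOfBasisRight b).injective
  ext i
  rw [key, key, h]

lemma eq_of_sliceL_eq {y z : M ⊗[K] N} (h : ∀ f : M →ₗ[K] K, sliceL f y = sliceL f z) : y = z := by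
  apply (TensorProduct.comm K M N).injective
  refine eq_of_sliceR_eq fun f => ?_
  have key : ∀ y : M ⊗[K] N, sliceR f (TensorProduct.comm K M N y) = sliceL f y := by
    intro y
    induction y with
    | zero => simp
    | add a c ha hc => simp [ha, hc]
    | tmul m n => simp
  rw [key, key, h]

lemma exists_projection (P : Submodule K M) :
    ∃ p : M →ₗ[K] M, (∀ m, p m ∈ P) ∧ ∀ m ∈ P, p m = m := by
  obtain ⟨π, hπ⟩ := LinearMap.exists_leftInverse_of_injective P.subtype (by simp)
  refine ⟨P.subtype ∘ₗ π, fun m => (π m).2, fun m hm => ?_⟩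
  have := LinearMap.congr_fun hπ ⟨m, hm⟩
  simpa using congrArg Subtype.val this

lemma mem_map₂_mk_of_slices {P : Submodule K M} {Q : Submodule K N} {x : M ⊗[K] N}
    (hP : ∀ f : N →ₗ[K] K, sliceR f x ∈ P) (hQ : ∀ f : M →ₗ[K] K, sliceL f x ∈ Q) :
    x ∈ Submodule.map₂ (TensorProduct.mk K M N) P Q := by
  obtain ⟨p, hp, hp'⟩ := exists_projection P
  obtain ⟨q, hq, hq'⟩ := exists_projection Q
  have h1 : LinearMap.rTensor N p x = x := by
    refine eq_of_sliceR_eq fun f => ?_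
    have key : ∀ y : M ⊗[K] N, sliceR f (LinearMap.rTensor N p y) = p (sliceR f y) := by
      intro y
      induction y with
      | zero => simp
      | add a c ha hc => simp [ha, hc]
      | tmul m n => simp
    rw [key, hp' _ (hP f)]
  have h2 : LinearMap.lTensor M q x = x := by
    refine eq_of_sliceL_eq fun f => ?_
    have key : ∀ y : M ⊗[K] N, sliceL f (LinearMap.lTensor M q y) = q (sliceL f y) := by
      intro y
      induction y with
      | zero => simp
      | add a c ha hc => simp [ha, hc]
      | tmul m n => simp
    rw [key, hq' _ (hQ f)]
  have key : ∀ y : M ⊗[K] N, LinearMap.rTensor N p (LinearMap.lTensor M q y) ∈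
      Submodule.map₂ (TensorProduct.mk K M N) P Q := by
    intro y
    induction y with
    | zero => simp
    | add a c ha hc => simpa using add_mem ha hc
    | tmul m n => exact Submodule.apply_mem_map₂ _ (hp m) (hq n)
  rw [← h1, ← h2]
  exact key x

lemma sliceR_mem_of_mem_map₂ {P : Submodule K M} {Q : Submodule K N} {x : M ⊗[K] N}
    (hx : x ∈ Submodule.map₂ (TensorProduct.mk K M N) P Q) (f : N →ₗ[K] K) : sliceR f x ∈ P := by
  have : Submodule.map₂ (TensorProduct.mk K M N) P Q ≤ P.comap (sliceR f) :=
    Submodule.map₂_le.2 fun m hm n _ => by simpa using P.smul_mem _ hm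
  exact this hx

lemma sliceL_mem_of_mem_map₂ {P : Submodule K M} {Q : Submodule K N} {x : M ⊗[K] N}
    (hx : x ∈ Submodule.map₂ (TensorProduct.mk K M N) P Q) (f : M →ₗ[K] K) : sliceL f x ∈ Q := by
  have : Submodule.map₂ (TensorProduct.mk K M N) P Q ≤ Q.comap (sliceL f) :=
    Submodule.map₂_le.2 fun m _ n hn => by simpa using Q.smul_mem _ hn
  exact this hx

end Slices

variable {K H}

lemma exists_leftIntegral {A : Type*} [Ring A] [Algebra K A] [IsSemisimpleRing A]
    (e : A →ₐ[K] K) : ∃ t : A, e t = 1 ∧ ∀ a, a * t = e a • t := by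
  obtain ⟨J, hJ⟩ := exists_isCompl (RingHom.ker e)
  have h1 : (1 : A) ∈ RingHom.ker e ⊔ J := by rw [hJ.sup_eq_top]; trivial
  obtain ⟨k, hk, t, ht, hkt⟩ := Submodule.mem_sup.1 h1
  have het : e t = 1 := by
    have := congrArg e hkt
    rwa [map_add, (RingHom.mem_ker).1 hk, zero_add, map_one] at this
  refine ⟨t, het, fun a => ?_⟩
  have h0 : (a - algebraMap K A (e a)) * t ∈ RingHom.ker e ⊓ J := by
    refine ⟨?_, J.smul_mem _ ht⟩
    simp [RingHom.mem_ker]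
  rw [hJ.inf_eq_bot, Submodule.mem_bot, sub_mul, sub_eq_zero] at h0
  rw [h0, Algebra.smul_def]

lemma exists_integral (hss : IsSemisimpleRing H) : ∃ t : H, counit (R := K) t = 1 ∧
    (∀ a, a * t = counit (R := K) a • t) ∧ ∀ a, t * a = counit (R := K) a • t := by
  obtain ⟨t, h1, h2⟩ := exists_leftIntegral (Bialgebra.counitAlgHom K H)
  obtain ⟨u, h3, h4⟩ := exists_leftIntegral
    ((Bialgebra.counitAlgHom K H).fromOpposite fun _ _ => Commute.all _ _)
  have h5 : ∀ a, u.unop * a = counit (R := K) a • u.unop := fun a =>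
    congrArg MulOpposite.unop (h4 (MulOpposite.op a))
  have h6 : u.unop = t := by
    have e1 := h2 u.unop
    have e2 := h5 t
    have h3' : counit (R := K) u.unop = 1 := h3
    have h1' : counit (R := K) t = 1 := h1
    rw [h1', one_smul] at e2
    have e1' : u.unop * t = counit (R := K) u.unop • t := e1
    rw [h3', one_smul, e2] at e1'
    exact e1'
  exact ⟨t, h1, h2, h6 ▸ h5⟩

/-- Stability of a subspace under all slices of the comultiplication. -/
def SliceStable (C : Submodule K H) : Prop :=
  ∀ d ∈ C, ∀ f : H →ₗ[K] K, sliceR f (comul (R := K) d) ∈ C ∧ sliceL f (comul (R := K) d) ∈ C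

lemma sliceStable_iff {C : Submodule K H} : SliceStable C ↔ IsSubcoalgebra K H C :=
  ⟨fun h d hd => mem_map₂_mk_of_slices (fun f => (h d hd f).1) fun f => (h d hd f).2,
    fun h d hd f => ⟨sliceR_mem_of_mem_map₂ (h d hd) f, sliceL_mem_of_mem_map₂ (h d hd) f⟩⟩

lemma SliceStable.inf {C E : Submodule K H} (hC : SliceStable C) (hE : SliceStable E) :
    SliceStable (C ⊓ E) := fun d hd f =>
  ⟨⟨(hC d hd.1 f).1, (hE d hd.2 f).1⟩, ⟨(hC d hd.1 f).2, (hE d hd.2 f).2⟩⟩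

lemma SliceStable.sup {C E : Submodule K H} (hC : SliceStable C) (hE : SliceStable E) :
    SliceStable (C ⊔ E) := by
  intro d hd f
  obtain ⟨c, hc, e, he, rfl⟩ := Submodule.mem_sup.1 hd
  simp only [map_add]
  exact ⟨Submodule.add_mem_sup (hC c hc f).1 (hE e he f).1,
    Submodule.add_mem_sup (hC c hc f).2 (hE e he f).2⟩

lemma sliceStable_span_one : SliceStable (Submodule.span K {(1 : H)}) := by
  intro d hd f
  obtain ⟨a, rfl⟩ := Submodule.mem_span_singleton.1 hd
  simp only [map_smul, Bialgebra.comul_one, Algebra.TensorProduct.one_def, sliceR_tmul,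
    sliceL_tmul]
  have h1 := Submodule.mem_span_singleton_self (R := K) (1 : H)
  exact ⟨Submodule.smul_mem _ _ (Submodule.smul_mem _ _ h1),
    Submodule.smul_mem _ _ (Submodule.smul_mem _ _ h1)⟩

lemma exists_coIntegral [FiniteDimensional K H] [Nontrivial H] (hcoss : IsCosemisimpleCoalgebra K H) :
    ∃ φ : H →ₗ[K] K, φ 1 = 1 ∧ (∀ x, sliceL φ (comul (R := K) x) = φ x • 1) ∧
      ∀ x, sliceR φ (comul (R := K) x) = φ x • 1 := by
  obtain ⟨C, ⟨hC, h1C⟩, hmax⟩ := set_has_maximal_iff_noetherian.2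
    (inferInstance : IsNoetherian K H) {C : Submodule K H | SliceStable C ∧ (1 : H) ∉ C}
    ⟨⊥, by intro d hd f; simp [(Submodule.mem_bot K).1 hd], by simp⟩
  have htop : Submodule.span K {(1 : H)} ⊔ C = ⊤ := by
    rw [eq_top_iff, ← hcoss]
    refine sSup_le fun E hE => ?_
    have hE' := sliceStable_iff.2 hE.2.1
    rcases hE.2.2 _ inf_le_left (sliceStable_iff.1 (hE'.inf (sliceStable_span_one.sup hC)))
      with h | h
    · have h1 : (1 : H) ∉ C ⊔ E := by
        intro h1
        obtain ⟨c, hc, e, he, hce⟩ := Submodule.mem_sup.1 h1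
        have hmem : e ∈ E ⊓ (Submodule.span K {(1 : H)} ⊔ C) := by
          refine ⟨he, ?_⟩
          rw [show e = 1 + -c by rw [← hce]; abel]
          exact Submodule.add_mem_sup (Submodule.mem_span_singleton_self _) (neg_mem hc)
        rw [h, Submodule.mem_bot] at hmem
        rw [hmem, add_zero] at hce
        exact h1C (hce ▸ hc)
      have h2 : C ⊔ E ≤ C := by
        by_contra hlt
        exact hmax _ ⟨hC.sup hE', h1⟩ (lt_of_le_not_ge le_sup_left hlt)
      exact (le_sup_right.trans h2).trans le_sup_right
    · rw [← h]; exact inf_le_right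
  obtain ⟨ψ, hψ1, hψC⟩ := Submodule.exists_dual_map_eq_bot_of_notMem h1C inferInstance
  have hψC' : ∀ c ∈ C, ψ c = 0 := fun c hc => by
    have : ψ c ∈ C.map ψ := Submodule.mem_map_of_mem hc
    rwa [hψC, Submodule.mem_bot] at this
  refine ⟨(ψ 1)⁻¹ • ψ, by simp [hψ1], ?_⟩
  set φ := (ψ 1)⁻¹ • ψ with hφ
  have hφ1 : φ 1 = 1 := by simp [hφ, hψ1]
  have hφC : ∀ c ∈ C, φ c = 0 := fun c hc => by simp [hφ, hψC' c hc]
  have hL : Submodule.map₂ (TensorProduct.mk K H H) C C ≤ LinearMap.ker (sliceL φ) :=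
    Submodule.map₂_le.2 fun m hm n _ => by simp [hφC m hm]
  have hR : Submodule.map₂ (TensorProduct.mk K H H) C C ≤ LinearMap.ker (sliceR φ) :=
    Submodule.map₂_le.2 fun m _ n hn => by simp [hφC n hn]
  have hx : ∀ x : H, ∃ a : K, ∃ c ∈ C, x = a • 1 + c := fun x => by
    have : x ∈ Submodule.span K {(1 : H)} ⊔ C := by rw [htop]; trivial
    obtain ⟨y, hy, c, hc, rfl⟩ := Submodule.mem_sup.1 this
    obtain ⟨a, rfl⟩ := Submodule.mem_span_singleton.1 hy
    exact ⟨a, c, hc, rfl⟩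
  constructor
  · intro x
    obtain ⟨a, c, hc, rfl⟩ := hx x
    have := LinearMap.mem_ker.1 (hL (sliceStable_iff.1 hC c hc))
    simp [this, hφ1, hφC c hc, Algebra.TensorProduct.one_def]
  · intro x
    obtain ⟨a, c, hc, rfl⟩ := hx x
    have := LinearMap.mem_ker.1 (hR (sliceStable_iff.1 hC c hc))
    simp [this, hφ1, hφC c hc, Algebra.TensorProduct.one_def]

end HopfAux

namespace HopfAux

open Coalgebra HopfAlgebra

variable {K H} {A : Type*} [Ring A] [Algebra K A]

lemma conv_mulRight_comp (f g : H →ₗ[K] A) (a : A) :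
    conv f (LinearMap.mulRight K a ∘ₗ g) = LinearMap.mulRight K a ∘ₗ conv f g := by
  rw [← conv_counitSMul, ← conv_assoc, conv_counitSMul]

lemma mulLeft_comp_conv (f g : H →ₗ[K] A) (a : A) :
    conv (LinearMap.mulLeft K a ∘ₗ f) g = LinearMap.mulLeft K a ∘ₗ conv f g := by
  rw [← counitSMul_conv, conv_assoc, counitSMul_conv]

/-- The inclusion of the left tensor factor. -/
noncomputable def inl : H →ₐ[K] H ⊗[K] H := Algebra.TensorProduct.includeLeft

/-- The inclusion of the right tensor factor. -/
noncomputable def inr : H →ₐ[K] H ⊗[K] H := Algebra.TensorProduct.includeRight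

lemma inl_apply (h : H) : inl (K := K) h = h ⊗ₜ[K] 1 := rfl

lemma inr_apply (h : H) : inr (K := K) h = 1 ⊗ₜ[K] h := rfl

lemma conv_inl_inr : conv (inl (K := K) (H := H)).toLinearMap (inr (K := K)).toLinearMap
    = Coalgebra.comul := by
  ext h
  rw [conv_apply_repr _ _ (ℛ K h)]
  simp [inl_apply, inr_apply, (ℛ K h).eq]

lemma conv_antipode_comul : conv ((inl (K := K) (H := H)).toLinearMap ∘ₗ antipode K)
    Coalgebra.comul = (inr (K := K)).toLinearMap := by
  rw [← conv_inl_inr, ← conv_assoc, algHom_comp_antipode_conv, counitSMul_one_conv]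

lemma conv_comul_antipode : conv Coalgebra.comul
    ((inr (K := K) (H := H)).toLinearMap ∘ₗ antipode K) = (inl (K := K)).toLinearMap := by
  rw [← conv_inl_inr, conv_assoc, algHom_conv_comp_antipode, conv_counitSMul_one]

lemma one_tmul_mul_comul {t : H} (ht : ∀ a, a * t = counit (R := K) a • t) (h : H) :
    (1 ⊗ₜ h) * comul (R := K) t = (antipode K h ⊗ₜ 1) * comul (R := K) t := by
  have e : LinearMap.mulRight K (comul (R := K) t) ∘ₗ comul
      = counitSMul (K := K) (H := H) (comul (R := K) t) := by
    ext a
    simp [← Bialgebra.comul_mul, ht]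
  have := LinearMap.congr_fun (congrArg (fun F => LinearMap.mulRight K (comul (R := K) t) ∘ₗ F)
    (conv_antipode_comul (K := K) (H := H))) h
  rw [← conv_mulRight_comp, e, conv_counitSMul] at this
  exact this.symm

lemma comul_mul_tmul_one {t : H} (ht : ∀ a, t * a = counit (R := K) a • t) (h : H) :
    comul (R := K) t * (h ⊗ₜ 1) = comul (R := K) t * (1 ⊗ₜ antipode K h) := by
  have e : LinearMap.mulLeft K (comul (R := K) t) ∘ₗ comul
      = counitSMul (K := K) (H := H) (comul (R := K) t) := by
    ext a
    simp [← Bialgebra.comul_mul, ht]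
  have := LinearMap.congr_fun (congrArg (fun F => LinearMap.mulLeft K (comul (R := K) t) ∘ₗ F)
    (conv_comul_antipode (K := K) (H := H))) h
  rw [← mulLeft_comp_conv, e, counitSMul_conv] at this
  exact this.symm

lemma sliceL_mul_mul (φ : H →ₗ[K] K) (a b : H) (z : H ⊗[K] H) :
    sliceL φ ((1 ⊗ₜ a) * z * (1 ⊗ₜ b)) = a * sliceL φ z * b := by
  induction z with
  | zero => simp
  | add x y hx hy => simp [mul_add, add_mul, hx, hy]
  | tmul u v => simp

lemma sliceR_mul_mul (φ : H →ₗ[K] K) (a b : H) (z : H ⊗[K] H) :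
    sliceR φ ((a ⊗ₜ 1) * z * (b ⊗ₜ 1)) = a * sliceR φ z * b := by
  induction z with
  | zero => simp
  | add x y hx hy => simp [mul_add, add_mul, hx, hy]
  | tmul u v => simp

lemma apply_sliceL_eq_apply_sliceR (φ : H →ₗ[K] K) (z : H ⊗[K] H) :
    φ (sliceL φ z) = φ (sliceR φ z) := by
  induction z with
  | zero => simp
  | add x y hx hy => simp [hx, hy]
  | tmul u v => simp [mul_comm]

lemma sum_coord_sliceL {ι : Type*} [Fintype ι] (b : Module.Basis ι K H) (φ : H →ₗ[K] K)
    (z : H ⊗[K] H) :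
    ∑ i, b.coord i (sliceL φ (z * (antipode K (b i) ⊗ₜ 1)))
      = φ (LinearMap.mul' K H (LinearMap.lTensor H (antipode K) z)) := by
  induction z with
  | zero => simp
  | add x y hx hy => simp only [add_mul, map_add, Finset.sum_add_distrib, hx, hy]
  | tmul u v =>
    have h := congrArg (fun w => φ (u * antipode K w)) (b.sum_repr v)
    simp only [map_sum, map_smul, Finset.mul_sum, mul_smul_comm, smul_eq_mul] at h
    simpa [mul_comm] using h

lemma apply_leftIntegral_ne_zero [FiniteDimensional K H] {φ : H →ₗ[K] K} {t : H} (hφ1 : φ 1 = 1)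
    (hφL : ∀ x, sliceL φ (comul (R := K) x) = φ x • 1) (ht1 : counit (R := K) t = 1)
    (ht : ∀ a, t * a = counit (R := K) a • t) : φ t ≠ 0 := by
  intro h0
  have h := sum_coord_sliceL (Module.finBasis K H) φ (comul (R := K) t)
  rw [mul_antipode_lTensor_comul_apply, ht1, map_one, hφ1] at h
  refine one_ne_zero (h.symm.trans (Finset.sum_eq_zero fun i _ => ?_))
  rw [comul_mul_tmul_one ht]
  have := sliceL_mul_mul φ 1 (antipode K (antipode K (Module.finBasis K H i))) (comul (R := K) t)
  rw [hφL, h0, ← Algebra.TensorProduct.one_def, one_mul] at this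
  rw [this]
  simp

lemma antipode_injective_of_integral {φ : H →ₗ[K] K} {t : H} (hc : φ t ≠ 0)
    (hφR : ∀ x, sliceR φ (comul (R := K) x) = φ x • 1)
    (ht : ∀ a, t * a = counit (R := K) a • t) : Function.Injective (antipode K (A := H)) := by
  rw [← LinearMap.ker_eq_bot, LinearMap.ker_eq_bot']
  intro x hx
  have h1 := sliceR_mul_mul φ 1 x (comul (R := K) t)
  rw [← Algebra.TensorProduct.one_def, one_mul, comul_mul_tmul_one ht, hx, hφR] at h1
  simpa [hc] using h1.symm

lemma apply_mul_antipode {φ : H →ₗ[K] K} {t : H} (hc : φ t ≠ 0)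
    (hφL : ∀ x, sliceL φ (comul (R := K) x) = φ x • 1)
    (hφR : ∀ x, sliceR φ (comul (R := K) x) = φ x • 1)
    (htL : ∀ a, a * t = counit (R := K) a • t) (htR : ∀ a, t * a = counit (R := K) a • t)
    (a b : H) : φ (a * antipode K b) = φ (antipode K a * b) := by
  have h := apply_sliceL_eq_apply_sliceR φ ((1 ⊗ₜ a) * comul (R := K) t * (b ⊗ₜ 1))
  conv_lhs at h => rw [mul_assoc, comul_mul_tmul_one htR, ← mul_assoc, sliceL_mul_mul, hφL]
  rw [one_tmul_mul_comul htL, sliceR_mul_mul, hφR] at h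
  simpa [hc] using h

lemma apply_ad_eq {φ : H →ₗ[K] K} (hS : Function.Surjective (antipode K (A := H)))
    (hφ : ∀ a b : H, φ (a * antipode K b) = φ (antipode K a * b)) (h x : H) :
    φ (ad (K := K) h x) = counit (R := K) h * φ x := by
  obtain ⟨y, rfl⟩ := hS x
  have h1 : φ (antipode K y) = φ y := by simpa using hφ 1 y
  rw [ad_apply_repr (ℛ K h), map_sum, h1]
  have h2 := congrArg (fun z => φ (z * y)) (sum_antipode_mul_eq_smul (ℛ K h))
  simp only [Finset.sum_mul, map_sum, smul_mul_assoc, one_mul, map_smul, smul_eq_mul] at h2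
  rw [← h2]
  refine Finset.sum_congr rfl fun i _ => ?_
  rw [mul_assoc, ← antipode_mul_antidistrib, hφ, mul_assoc]

/-- The integral data extracted from semisimplicity and cosemisimplicity. -/
lemma exists_adInvariant_integral [FiniteDimensional K H] (hss : IsSemisimpleRing H)
    (hcoss : IsCosemisimpleCoalgebra K H) :
    Function.Bijective (antipode K (A := H)) ∧ ∃ φ : H →ₗ[K] K, φ 1 = 1 ∧
      (∀ x, sliceR φ (comul (R := K) x) = φ x • 1) ∧
      ∀ h x, φ (ad (K := K) h x) = counit (R := K) h * φ x := by
  have : Nontrivial H := (Bialgebra.counitAlgHom K H).toRingHom.domain_nontrivial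
  obtain ⟨t, ht1, htL, htR⟩ := exists_integral (K := K) hss
  obtain ⟨φ, hφ1, hφL, hφR⟩ := exists_coIntegral hcoss
  have hc := apply_leftIntegral_ne_zero hφ1 hφL ht1 htR
  have hinj := antipode_injective_of_integral hc hφR htR
  have hsurj := LinearMap.injective_iff_surjective.1 hinj
  exact ⟨⟨hinj, hsurj⟩, φ, hφ1, hφR,
    apply_ad_eq hsurj (apply_mul_antipode hc hφL hφR htL htR)⟩

end HopfAux

namespace HopfAux

open Coalgebra HopfAlgebra

variable {K H} {R : H ⊗[K] H} {T : Finset (H × H)}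

lemma sliceL_counit_eq_one (hR : IsQuasiTriangular K H R) :
    sliceL (counit (R := K)) R = (1 : H) := by
  have h1 : ∀ z : H ⊗[K] H, sliceL (counit (R := K)) (TensorProduct.assoc K H H H
      (LinearMap.rTensor H (comul (R := K)) z)) = z := by
    intro z
    induction z with
    | zero => simp
    | add x y hx hy => simp only [map_add, hx, hy]
    | tmul u v =>
      conv_rhs => rw [← sum_counit_smul (ℛ K u)]
      simp [← (ℛ K u).eq, TensorProduct.sum_tmul, TensorProduct.smul_tmul']
  have h2 : ∀ z : H ⊗[K] H, sliceL (counit (R := K)) (r13 K H z * r23 K H R)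
      = (1 ⊗ₜ sliceL (counit (R := K)) z) * R := by
    intro z
    induction z with
    | zero => simp [r13]
    | add x y hx hy =>
      have : r13 K H (x + y) = r13 K H x + r13 K H y := by simp [r13]
      rw [this]
      simp only [map_add, add_mul, hx, hy, TensorProduct.tmul_add]
    | tmul u v => simp [r13, r23]
  have h3 := h1 R
  rw [hR.comul_rTensor, h2] at h3
  have h4 : (1 : H) ⊗ₜ[K] sliceL (counit (R := K)) R = 1 :=
    hR.isUnit.mul_right_cancel (h3.trans (one_mul R).symm)
  simpa [Algebra.TensorProduct.one_def] using congrArg (sliceL (counit (R := K))) h4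

lemma sliceR_counit_eq_one (hR : IsQuasiTriangular K H R) :
    sliceR (counit (R := K)) R = (1 : H) := by
  have h1 : ∀ z : H ⊗[K] H, LinearMap.lTensor H (sliceR (counit (R := K)))
      (LinearMap.lTensor H (comul (R := K)) z) = z := by
    intro z
    induction z with
    | zero => simp
    | add x y hx hy => simp only [map_add, hx, hy]
    | tmul u v =>
      have h := congrArg (TensorProduct.rid K H) (sum_tmul_counit_eq (ℛ K v))
      simp only [map_sum, TensorProduct.rid_tmul, one_smul] at h
      conv_rhs => rw [← h]
      simp [← (ℛ K v).eq]
  have h2 : ∀ z w : H ⊗[K] H, LinearMap.lTensor H (sliceR (counit (R := K)))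
      (r13 K H z * r12 K H w) = (sliceR (counit (R := K)) z ⊗ₜ 1) * w := by
    intro z w
    induction z with
    | zero => simp [r13]
    | add x y hx hy =>
      have : r13 K H (x + y) = r13 K H x + r13 K H y := by simp [r13]
      rw [this]
      simp only [map_add, add_mul, hx, hy, TensorProduct.add_tmul]
    | tmul u v =>
      induction w with
      | zero => simp [r12]
      | add x y hx hy =>
        have : r12 K H (x + y) = r12 K H x + r12 K H y := by simp [r12]
        rw [this]
        simp only [map_add, mul_add, hx, hy]
      | tmul x y => simp [r13, r12, TensorProduct.smul_tmul']
  have h3 := h1 R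
  rw [hR.comul_lTensor, h2] at h3
  have h4 : sliceR (counit (R := K)) R ⊗ₜ[K] (1 : H) = 1 :=
    hR.isUnit.mul_right_cancel (h3.trans (one_mul R).symm)
  simpa [Algebra.TensorProduct.one_def] using congrArg (sliceR (counit (R := K))) h4

lemma sum_mul_tmul_antipode_mul (hR : IsQuasiTriangular K H R)
    (hT : R = ∑ i ∈ T, i.1 ⊗ₜ[K] i.2) :
    ∑ j ∈ T, ∑ i ∈ T, (j.1 * i.1) ⊗ₜ[K] (antipode K i.2 * j.2) = 1 ⊗ₜ 1 := by
  have h1 : ∀ z : H ⊗[K] H, LinearMap.lTensor H (LinearMap.mul' K H ∘ₗ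
      LinearMap.rTensor H (antipode K)) (LinearMap.lTensor H (comul (R := K)) z)
      = sliceR (counit (R := K)) z ⊗ₜ 1 := by
    intro z
    induction z with
    | zero => simp
    | add x y hx hy => simp only [map_add, hx, hy, TensorProduct.add_tmul]
    | tmul u v =>
      simp [mul_antipode_rTensor_comul_apply, Algebra.algebraMap_eq_smul_one,
        TensorProduct.smul_tmul']
  have h2 := h1 R
  rw [hR.comul_lTensor, sliceR_counit_eq_one hR] at h2
  rw [← h2, hT]
  simp [r13, r12, Finset.sum_mul_sum]

lemma sum_counit_smul_snd (hR : IsQuasiTriangular K H R) (hT : R = ∑ i ∈ T, i.1 ⊗ₜ[K] i.2) :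
    ∑ i ∈ T, counit (R := K) i.1 • i.2 = (1 : H) := by
  rw [← sliceL_counit_eq_one hR, hT]
  simp

lemma deltaR_apply_repr (hT : R = ∑ i ∈ T, i.1 ⊗ₜ[K] i.2) {ι : Type*} {h : H} (r : Repr K h ι) :
    deltaR K H R h = ∑ i ∈ T, ∑ k ∈ r.index,
      (r.left k * antipode K i.2) ⊗ₜ[K] ad (K := K) i.1 (r.right k) := by
  simp [deltaR, ← r.eq, hT, adMap_tmul]

/-- The braided antipode `b ↦ R² S(R¹ ·_ad b)` of the transmuted group. -/
noncomputable def braidedAntipode (T : Finset (H × H)) : H →ₗ[K] H :=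
  ∑ i ∈ T, LinearMap.mulLeft K i.2 ∘ₗ antipode K ∘ₗ ad (K := K) i.1

lemma mul_braidedAntipode (hR : IsQuasiTriangular K H R) (hT : R = ∑ i ∈ T, i.1 ⊗ₜ[K] i.2) :
    LinearMap.mul' K H ∘ₗ LinearMap.lTensor H (braidedAntipode T) ∘ₗ deltaR K H R
      = counitSMul (K := K) (1 : H) := by
  ext h
  have hQ : ∀ l r : H, ∑ i ∈ T, ∑ j ∈ T, l * antipode K i.2 *
      (j.2 * antipode K (ad (K := K) j.1 (ad (K := K) i.1 r))) = l * antipode K r := by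
    intro l r
    have := congrArg (LinearMap.mul' K H ∘ₗ TensorProduct.map (LinearMap.mulLeft K l)
      (antipode K ∘ₗ (ad (K := K)).flip r) ∘ₗ (TensorProduct.comm K H H).toLinearMap)
      (sum_mul_tmul_antipode_mul hR hT)
    rw [Finset.sum_comm] at this
    simpa [ad_mul_apply, ad_one_apply, mul_assoc] using this
  have e : (LinearMap.mul' K H ∘ₗ LinearMap.lTensor H (braidedAntipode T) ∘ₗ deltaR K H R) h
      = ∑ k ∈ (ℛ K h).index, ∑ i ∈ T, ∑ j ∈ T, (ℛ K h).left k * antipode K i.2 *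
      (j.2 * antipode K (ad (K := K) j.1 (ad (K := K) i.1 ((ℛ K h).right k)))) := by
    rw [Finset.sum_comm]
    simp [deltaR_apply_repr hT (ℛ K h), braidedAntipode, Finset.mul_sum]
  rw [e, Finset.sum_congr rfl fun k _ => hQ _ _, sum_mul_antipode_eq_smul]
  rfl

lemma ad_mul_eq_sum {ι : Type*} {h : H} (r : Repr K h ι) (p q : H) :
    ad (K := K) h (p * q) = ∑ i ∈ r.index, ad (K := K) (r.left i) p * ad (K := K) (r.right i) q := by
  have := LinearMap.congr_fun (ad_apply_mul (K := K) p q) h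
  rwa [conv_apply_repr _ _ r] at this

lemma deltaR_mul (hR : IsQuasiTriangular K H R) (hT : R = ∑ i ∈ T, i.1 ⊗ₜ[K] i.2)
    {ι : Type*} {p : H} (r : Repr K p ι) (q : H) :
    deltaR K H R (p * q) = ∑ c ∈ T, ∑ k ∈ r.index,
      TensorProduct.map (LinearMap.mulLeft K (r.left k) ∘ₗ LinearMap.mulRight K (antipode K c.2))
        (LinearMap.mulLeft K (ad (K := K) c.1 (r.right k))) (deltaR K H R q) := by
  have hG : ∀ p1 p2 q1 q2 : H, ∑ i ∈ T, (p1 * q1 * antipode K i.2) ⊗ₜ[K] ad (K := K) i.1 (p2 * q2)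
      = ∑ c ∈ T, ∑ i ∈ T, (p1 * (q1 * antipode K i.2 * antipode K c.2)) ⊗ₜ[K]
        (ad (K := K) c.1 p2 * ad (K := K) i.1 q2) := by
    intro p1 p2 q1 q2
    have := congrArg ((TensorProduct.comm K H H).toLinearMap ∘ₗ TensorProduct.map
      (LinearMap.mul' K H ∘ₗ TensorProduct.map ((ad (K := K)).flip p2) ((ad (K := K)).flip q2))
      (LinearMap.mulLeft K (p1 * q1) ∘ₗ antipode K) ∘ₗ
      (TensorProduct.assoc K H H H).symm.toLinearMap) hR.comul_rTensor
    rw [hT] at this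
    simp only [LinearMap.comp_apply, LinearEquiv.coe_coe, LinearEquiv.symm_apply_apply] at this
    have e : ∀ i : H × H, (p1 * q1 * antipode K i.2) ⊗ₜ[K] ad (K := K) i.1 (p2 * q2) =
      TensorProduct.comm K H H (TensorProduct.map
      (LinearMap.mul' K H ∘ₗ TensorProduct.map ((ad (K := K)).flip p2) ((ad (K := K)).flip q2))
      (LinearMap.mulLeft K (p1 * q1) ∘ₗ antipode K)
        (LinearMap.rTensor H (comul (R := K)) (i.1 ⊗ₜ i.2))) := by
      intro i
      rw [ad_mul_eq_sum (ℛ K i.1)]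
      simp [← (ℛ K i.1).eq, mul_assoc]
    rw [Finset.sum_congr rfl fun i _ => e i]
    simp only [← map_sum]
    rw [this]
    simp [r13, r23, TensorProduct.tmul_sum, Finset.sum_mul_sum, antipode_mul_antidistrib, mul_assoc]
  have e : comul (R := K) (p * q) = ∑ k ∈ r.index, ∑ l ∈ (ℛ K q).index,
      (r.left k * (ℛ K q).left l) ⊗ₜ[K] (r.right k * (ℛ K q).right l) := by
    rw [Bialgebra.comul_mul, ← r.eq, ← (ℛ K q).eq, Finset.sum_mul_sum]
    simp
  have e' : deltaR K H R (p * q) = ∑ k ∈ r.index, ∑ l ∈ (ℛ K q).index, ∑ i ∈ T,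
      (r.left k * (ℛ K q).left l * antipode K i.2) ⊗ₜ[K]
        ad (K := K) i.1 (r.right k * (ℛ K q).right l) := by
    simp only [deltaR, LinearMap.comp_apply, e, map_sum, hT]
    simp [adMap_tmul]
  rw [e']
  simp only [hG]
  rw [Finset.sum_comm (s := T)]
  refine Finset.sum_congr rfl fun k _ => ?_
  rw [Finset.sum_comm]
  refine Finset.sum_congr rfl fun c _ => ?_
  rw [deltaR_apply_repr hT (ℛ K q), Finset.sum_comm]
  simp

end HopfAux

namespace HopfAux

open Coalgebra HopfAlgebra

section SliceNaturality

variable {K : Type*} [Field K] {L M N P : Type*} [AddCommGroup L] [Module K L] [AddCommGroup M]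
  [Module K M] [AddCommGroup N] [Module K N] [AddCommGroup P] [Module K P]

lemma sliceL_lTensor (f : M →ₗ[K] K) (g : N →ₗ[K] P) (x : M ⊗[K] N) :
    sliceL f (LinearMap.lTensor M g x) = g (sliceL f x) := by
  induction x with
  | zero => simp
  | add x y hx hy => simp only [map_add, hx, hy]
  | tmul u v => simp

lemma sliceR_lTensor (f : P →ₗ[K] K) (g : N →ₗ[K] P) (x : M ⊗[K] N) :
    sliceR f (LinearMap.lTensor M g x) = sliceR (f ∘ₗ g) x := by
  induction x with
  | zero => simp
  | add x y hx hy => simp only [map_add, hx, hy]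
  | tmul u v => simp

lemma sliceL_rTensor (f : P →ₗ[K] K) (g : M →ₗ[K] P) (x : M ⊗[K] N) :
    sliceL f (LinearMap.rTensor N g x) = sliceL (f ∘ₗ g) x := by
  induction x with
  | zero => simp
  | add x y hx hy => simp only [map_add, hx, hy]
  | tmul u v => simp

lemma sliceR_rTensor (f : N →ₗ[K] K) (g : M →ₗ[K] P) (x : M ⊗[K] N) :
    sliceR f (LinearMap.rTensor N g x) = g (sliceR f x) := by
  induction x with
  | zero => simp
  | add x y hx hy => simp only [map_add, hx, hy]
  | tmul u v => simp

lemma sliceL_assoc_symm (f : L →ₗ[K] K) (g : M →ₗ[K] K) (x : L ⊗[K] (M ⊗[K] N)) :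
    sliceL (LinearMap.mul' K K ∘ₗ TensorProduct.map f g) ((TensorProduct.assoc K L M N).symm x)
      = sliceL g (sliceL f x) := by
  induction x with
  | zero => simp
  | add x y hx hy => simp only [map_add, hx, hy]
  | tmul l y =>
    induction y with
    | zero => simp
    | add x y hx hy => simp only [map_add, TensorProduct.tmul_add, hx, hy]
    | tmul m n => simp [smul_smul]

lemma sliceR_assoc_symm_tmul (f : N →ₗ[K] K) (l : L) (y : M ⊗[K] N) :
    sliceR f ((TensorProduct.assoc K L M N).symm (l ⊗ₜ y)) = l ⊗ₜ sliceR f y := by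
  induction y with
  | zero => simp
  | add x y hx hy => simp only [map_add, TensorProduct.tmul_add, hx, hy]
  | tmul m n => simp

lemma sliceR_assoc_symm (f : N →ₗ[K] K) (x : L ⊗[K] (M ⊗[K] N)) :
    sliceR f ((TensorProduct.assoc K L M N).symm x) = LinearMap.lTensor L (sliceR f) x := by
  induction x with
  | zero => simp
  | add x y hx hy => simp only [map_add, hx, hy]
  | tmul l y => rw [sliceR_assoc_symm_tmul, LinearMap.lTensor_tmul]

end SliceNaturality

variable {K H} {R : H ⊗[K] H} {T : Finset (H × H)} {V : Type*} [AddCommGroup V] [Module K V]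

/-- Counitality and coassociativity of a coaction of the transmuted coalgebra. -/
structure IsCoaction (R : H ⊗[K] H) (ρ : V →ₗ[K] H ⊗[K] V) : Prop where
  counit : ∀ v, sliceL (Coalgebra.counit (R := K)) (ρ v) = v
  coassoc : ∀ v, LinearMap.rTensor V (deltaR K H R) (ρ v)
    = (TensorProduct.assoc K H H V).symm (LinearMap.lTensor H ρ (ρ v))

lemma _root_.RModStr.isCoaction (s : RModStr K H R V) : IsCoaction R s.coact :=
  ⟨s.counit_coact, fun v => LinearMap.congr_fun s.coassocR v⟩

/-- The map `a ⊗ w ↦ a g(w⁽⁻¹⁾) ⊗ w⁽⁰⁾`. -/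
noncomputable def twist (ρ : V →ₗ[K] H ⊗[K] V) (g : H →ₗ[K] H) : H ⊗[K] V →ₗ[K] H ⊗[K] V :=
  LinearMap.rTensor V (LinearMap.mul' K H) ∘ₗ (TensorProduct.assoc K H H V).symm.toLinearMap ∘ₗ
    LinearMap.lTensor H (LinearMap.rTensor V g ∘ₗ ρ)

lemma twist_tmul (ρ : V →ₗ[K] H ⊗[K] V) (g : H →ₗ[K] H) (a : H) (w : V) :
    twist ρ g (a ⊗ₜ w) = LinearMap.rTensor V (LinearMap.mulLeft K a ∘ₗ g) (ρ w) := by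
  simp only [twist, LinearMap.comp_apply, LinearMap.lTensor_tmul, LinearEquiv.coe_coe]
  induction ρ w with
  | zero => simp
  | add x y hx hy => simp only [map_add, TensorProduct.tmul_add, hx, hy]
  | tmul u v => simp

lemma twist_rTensor_mulLeft (ρ : V →ₗ[K] H ⊗[K] V) (g : H →ₗ[K] H) (a : H) (y : H ⊗[K] V) :
    twist ρ g (LinearMap.rTensor V (LinearMap.mulLeft K a) y)
      = LinearMap.rTensor V (LinearMap.mulLeft K a) (twist ρ g y) := by
  induction y with
  | zero => simp
  | add x y hx hy => simp only [map_add, hx, hy]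
  | tmul u v =>
    rw [LinearMap.rTensor_tmul, twist_tmul, twist_tmul,
      ← LinearMap.comp_apply (LinearMap.rTensor V (LinearMap.mulLeft K a)),
      ← LinearMap.rTensor_comp]
    congr 2
    ext x
    simp

lemma twist_braidedAntipode_coact (hR : IsQuasiTriangular K H R)
    (hT : R = ∑ i ∈ T, i.1 ⊗ₜ[K] i.2) {ρ : V →ₗ[K] H ⊗[K] V} (hρ : IsCoaction R ρ) (w : V) :
    twist ρ (braidedAntipode T) (ρ w) = 1 ⊗ₜ w := by
  have key : ∀ y : H ⊗[K] V, twist ρ (braidedAntipode T) y = LinearMap.rTensor V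
      (LinearMap.mul' K H ∘ₗ LinearMap.lTensor H (braidedAntipode T))
      ((TensorProduct.assoc K H H V).symm (LinearMap.lTensor H ρ y)) := by
    intro y
    induction y with
    | zero => simp
    | add x y hx hy => simp only [map_add, hx, hy]
    | tmul u v =>
      rw [twist_tmul, LinearMap.lTensor_tmul]
      induction ρ v with
      | zero => simp
      | add x y hx hy => simp only [map_add, TensorProduct.tmul_add, hx, hy]
      | tmul u v => simp
  have key2 : ∀ y : H ⊗[K] V, LinearMap.rTensor V (counitSMul (K := K) (1 : H)) y
      = 1 ⊗ₜ sliceL (counit (R := K)) y := by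
    intro y
    induction y with
    | zero => simp
    | add x y hx hy => simp only [map_add, TensorProduct.tmul_add, hx, hy]
    | tmul u v => simp [TensorProduct.smul_tmul]
  rw [key, ← hρ.coassoc, ← LinearMap.comp_apply, ← LinearMap.rTensor_comp, LinearMap.comp_assoc,
    mul_braidedAntipode hR hT, key2, hρ.counit]

lemma twist_braidedAntipode_twist (hR : IsQuasiTriangular K H R)
    (hT : R = ∑ i ∈ T, i.1 ⊗ₜ[K] i.2) {ρ : V →ₗ[K] H ⊗[K] V} (hρ : IsCoaction R ρ)
    (y : H ⊗[K] V) : twist ρ (braidedAntipode T) (twist ρ LinearMap.id y) = y := by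
  induction y with
  | zero => simp
  | add x y hx hy => simp only [map_add, hx, hy]
  | tmul u v =>
    rw [twist_tmul, LinearMap.comp_id, twist_rTensor_mulLeft,
      twist_braidedAntipode_coact hR hT hρ]
    simp

lemma exists_finite_subcomodule [FiniteDimensional K H] {ρ : V →ₗ[K] H ⊗[K] V}
    (hρ : IsCoaction R ρ) (v : V) : ∃ W : Submodule K V, W.FG ∧ v ∈ W ∧
      ∀ w ∈ W, ρ w ∈ Submodule.map₂ (TensorProduct.mk K H V) ⊤ W := by
  let F : (H →ₗ[K] K) →ₗ[K] V :=
    { toFun := fun f => sliceL f (ρ v)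
      map_add' := fun f g => by simp [sliceL, LinearMap.rTensor_add]
      map_smul' := fun c f => by simp [sliceL, LinearMap.rTensor_smul] }
  refine ⟨LinearMap.range F, ?_, ⟨counit (R := K), hρ.counit v⟩, ?_⟩
  · rw [← Submodule.fg_top, ← Module.finite_def]
    infer_instance
  · rintro _ ⟨f, rfl⟩
    refine mem_map₂_mk_of_slices (fun _ => trivial) fun g => ?_
    refine ⟨LinearMap.mul' K K ∘ₗ TensorProduct.map f g ∘ₗ deltaR K H R, ?_⟩
    change sliceL _ (ρ v) = sliceL g (ρ (sliceL f (ρ v)))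
    rw [← sliceL_lTensor f ρ, ← sliceL_assoc_symm, ← hρ.coassoc, sliceL_rTensor,
      LinearMap.comp_assoc]

lemma twist_id_surjective [FiniteDimensional K H] (hR : IsQuasiTriangular K H R)
    (hT : R = ∑ i ∈ T, i.1 ⊗ₜ[K] i.2) {ρ : V →ₗ[K] H ⊗[K] V} (hρ : IsCoaction R ρ) :
    Function.Surjective (twist ρ LinearMap.id) := by
  have hinj : Function.Injective (twist ρ LinearMap.id) :=
    Function.LeftInverse.injective (twist_braidedAntipode_twist hR hT hρ)
  intro y
  induction y with
  | zero => exact ⟨0, map_zero _⟩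
  | add x y hx hy =>
    obtain ⟨x, rfl⟩ := hx
    obtain ⟨y, rfl⟩ := hy
    exact ⟨x + y, map_add _ _ _⟩
  | tmul a v =>
    obtain ⟨W, hW, hv, hWρ⟩ := exists_finite_subcomodule hρ v
    obtain ⟨U, hU⟩ : ∃ U, U = Submodule.map₂ (TensorProduct.mk K H V) ⊤ W := ⟨_, rfl⟩
    have hmem : a ⊗ₜ v ∈ U := hU ▸ Submodule.apply_mem_map₂ _ Submodule.mem_top hv
    have hUfin : Module.Finite K U :=
      Module.Finite.of_fg (hU ▸ Submodule.FG.map₂ _ Module.Finite.fg_top hW)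
    have hstab : ∀ u ∈ U, twist ρ LinearMap.id u ∈ U := by
      have hle : Submodule.map₂ (TensorProduct.mk K H V) ⊤ W ≤ U.comap (twist ρ LinearMap.id) := by
        refine Submodule.map₂_le.2 fun b _ w hw => ?_
        rw [Submodule.mem_comap, TensorProduct.mk_apply, twist_tmul, hU]
        refine mem_map₂_mk_of_slices (fun _ => Submodule.mem_top) fun g => ?_
        rw [sliceL_rTensor]
        exact sliceL_mem_of_mem_map₂ (hWρ w hw) _
      rwa [← hU] at hle
    have hinj' : Function.Injective ((twist ρ LinearMap.id).restrict hstab) := fun x y h =>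
      Subtype.ext (hinj (congrArg Subtype.val h))
    have hsurj : Function.Surjective ((twist ρ LinearMap.id).restrict hstab) :=
      (LinearMap.injective_iff_surjective (K := K) (V := U)).1 hinj'
    obtain ⟨u, hu⟩ := hsurj ⟨a ⊗ₜ v, hmem⟩
    exact ⟨u, congrArg Subtype.val hu⟩

/-- The retraction `a ⊗ w ↦ φ(a S_R(w⁽⁻¹⁾)) w⁽⁰⁾` of the coaction attached to an integral. -/
noncomputable def retraction (ρ : V →ₗ[K] H ⊗[K] V) (T : Finset (H × H)) (φ : H →ₗ[K] K) :
    H ⊗[K] V →ₗ[K] V :=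
  sliceL φ ∘ₗ twist ρ (braidedAntipode T)

section Retraction

variable {ρ : V →ₗ[K] H ⊗[K] V} {φ : H →ₗ[K] K}

lemma retraction_mulLeft_coact (hR : IsQuasiTriangular K H R) (hT : R = ∑ i ∈ T, i.1 ⊗ₜ[K] i.2)
    (hρ : IsCoaction R ρ) (a : H) (w : V) :
    retraction ρ T φ (LinearMap.rTensor V (LinearMap.mulLeft K a) (ρ w)) = φ a • w := by
  simp [retraction, twist_rTensor_mulLeft, twist_braidedAntipode_coact hR hT hρ]

lemma retraction_coact (hR : IsQuasiTriangular K H R) (hT : R = ∑ i ∈ T, i.1 ⊗ₜ[K] i.2)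
    (hρ : IsCoaction R ρ) (hφ1 : φ 1 = 1) (w : V) :
    retraction ρ T φ (ρ w) = w := by
  have := retraction_mulLeft_coact hR hT hρ (φ := φ) 1 w
  rwa [LinearMap.mulLeft_one, LinearMap.rTensor_id, LinearMap.id_apply, hφ1, one_smul] at this

lemma coact_retraction [FiniteDimensional K H] (hR : IsQuasiTriangular K H R)
    (hT : R = ∑ i ∈ T, i.1 ⊗ₜ[K] i.2) (hρ : IsCoaction R ρ)
    (hφR : ∀ x, sliceR φ (comul (R := K) x) = φ x • 1)
    (hφ : ∀ h x, φ (ad (K := K) h x) = counit (R := K) h * φ x) (y : H ⊗[K] V) :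
    ρ (retraction ρ T φ y) = LinearMap.lTensor H (retraction ρ T φ)
      (TensorProduct.assoc K H H V (LinearMap.rTensor V (deltaR K H R) y)) := by
  obtain ⟨y, rfl⟩ := twist_id_surjective hR hT hρ y
  induction y with
  | zero => simp
  | add x y hx hy => simp only [map_add, hx, hy]
  | tmul a w =>
    rw [twist_tmul, LinearMap.comp_id, retraction_mulLeft_coact hR hT hρ]
    let G : H × H → _ → H →ₗ[K] H := fun c k =>
      LinearMap.mulLeft K ((ℛ K a).left k) ∘ₗ LinearMap.mulRight K (antipode K c.2)
    have hδ : deltaR K H R ∘ₗ LinearMap.mulLeft K a = ∑ c ∈ T, ∑ k ∈ (ℛ K a).index,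
        TensorProduct.map (G c k) (LinearMap.mulLeft K (ad (K := K) c.1 ((ℛ K a).right k)))
          ∘ₗ deltaR K H R := by
      ext q
      simpa [G] using deltaR_mul hR hT (ℛ K a) q
    have hmap : ∀ (F g : H →ₗ[K] H) (z : H ⊗[K] (H ⊗[K] V)),
        TensorProduct.assoc K H H V (LinearMap.rTensor V (TensorProduct.map F g)
          ((TensorProduct.assoc K H H V).symm z)) = TensorProduct.map F (LinearMap.rTensor V g) z := by
      intro F g z
      induction z with
      | zero => simp
      | add x y hx hy => simp only [map_add, hx, hy]
      | tmul u y =>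
        induction y with
        | zero => simp
        | add x y hx hy => simp only [map_add, TensorProduct.tmul_add, hx, hy]
        | tmul m n => simp
    have hterm : ∀ (F : H →ₗ[K] H) (b : H) (z : H ⊗[K] V), LinearMap.lTensor H (retraction ρ T φ)
        (TensorProduct.map F (LinearMap.rTensor V (LinearMap.mulLeft K b))
          (LinearMap.lTensor H ρ z)) = LinearMap.rTensor V (φ b • F) z := by
      intro F b z
      induction z with
      | zero => simp
      | add x y hx hy => simp only [map_add, hx, hy]
      | tmul u v =>
        simp [retraction_mulLeft_coact hR hT hρ]
    have hsum : ∑ c ∈ T, ∑ k ∈ (ℛ K a).index,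
        φ (ad (K := K) c.1 ((ℛ K a).right k)) • G c k = φ a • LinearMap.id := by
      ext x
      have h1 := congrArg (antipode K (A := H)) (sum_counit_smul_snd hR hT)
      have h2 := hφR a
      rw [← (ℛ K a).eq] at h2
      simp only [map_sum, map_smul, antipode_one, sliceR_tmul] at h1 h2
      have h3 : ∑ c ∈ T, ∑ k ∈ (ℛ K a).index,
          φ (ad (K := K) c.1 ((ℛ K a).right k)) • G c k x =
          (∑ k ∈ (ℛ K a).index, φ ((ℛ K a).right k) • (ℛ K a).left k) * x *
            ∑ c ∈ T, counit (R := K) c.1 • antipode K c.2 := by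
        simp [Finset.sum_mul, Finset.mul_sum, Finset.smul_sum, hφ, G, smul_smul, mul_assoc]
      simpa [h1, h2] using h3
    rw [← LinearMap.comp_apply (LinearMap.rTensor V (deltaR K H R)), ← LinearMap.rTensor_comp, hδ]
    have hlin : ∀ (F : H →ₗ[K] H ⊗[K] H), LinearMap.rTensor V F (ρ w)
        = LinearMap.rTensorHom V F (ρ w) := fun _ => rfl
    rw [hlin]
    simp only [map_sum, LinearMap.sum_apply]
    simp only [LinearMap.coe_rTensorHom, LinearMap.rTensor_comp, LinearMap.comp_apply, hρ.coassoc,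
      hmap, hterm]
    rw [map_smul, show φ a • ρ w = LinearMap.rTensor V (φ a • LinearMap.id) (ρ w) by
      rw [LinearMap.rTensor_smul, LinearMap.rTensor_id]; rfl, ← hsum,
      ← LinearMap.coe_rTensorHom, map_sum]
    simp [LinearMap.sum_apply]

end Retraction

end HopfAux

namespace HopfAux

open Coalgebra HopfAlgebra

variable {K H} {R : H ⊗[K] H} {T : Finset (H × H)}

/-- The identities characterising an inverse of the antipode. -/
structure IsSkewAntipode (τ : H →ₗ[K] H) : Prop where
  apply_mul : ∀ h, LinearMap.mul' K H (LinearMap.rTensor H τ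
    (TensorProduct.comm K H H (comul (R := K) h))) = counit (R := K) h • 1
  mul_apply : ∀ h, LinearMap.mul' K H (LinearMap.lTensor H τ
    (TensorProduct.comm K H H (comul (R := K) h))) = counit (R := K) h • 1
  map_mul : ∀ a b, τ (a * b) = τ b * τ a

lemma exists_skewAntipode (hS : Function.Bijective (antipode K (A := H))) :
    ∃ τ : H →ₗ[K] H, IsSkewAntipode τ := by
  let e := LinearEquiv.ofBijective (antipode K (A := H)) hS
  have he : ∀ x, antipode K (e.symm x) = x := fun x => e.apply_symm_apply x
  refine ⟨e.symm.toLinearMap, ⟨fun h => hS.1 ?_, fun h => hS.1 ?_,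
    fun a b => hS.1 ?_⟩⟩
  · rw [map_smul, antipode_one, ← sum_antipode_mul_eq_smul (ℛ K h), ← (ℛ K h).eq]
    simp [antipode_mul_antidistrib, he]
  · rw [map_smul, antipode_one, ← sum_mul_antipode_eq_smul (ℛ K h), ← (ℛ K h).eq]
    simp [antipode_mul_antidistrib, he]
  · simp [antipode_mul_antidistrib, he]

variable {V : Type*} [AddCommGroup V] [Module K V]

lemma coact_act (s : RModStr K H R V) {ι : Type*} {h : H} (r : Repr K h ι) (v : V) :
    s.coact (s.act h v) = ∑ k ∈ r.index,
      TensorProduct.map (ad (K := K) (r.left k)) (s.act (r.right k)) (s.coact v) := by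
  have h1 := LinearMap.congr_fun s.compat (h ⊗ₜ v)
  have h2 : ∀ (l m : H) (y : H ⊗[K] V), TensorProduct.map (adMap K H)
      (TensorProduct.lift s.act.toLinearMap)
      (TensorProduct.tensorTensorTensorComm K H H H V ((l ⊗ₜ m) ⊗ₜ y))
      = TensorProduct.map (ad (K := K) l) (s.act m) y := by
    intro l m y
    induction y with
    | zero => simp
    | add x y hx hy => simp only [map_add, TensorProduct.tmul_add, hx, hy]
    | tmul u v => simp [adMap_tmul]
  simp only [LinearMap.comp_apply, TensorProduct.lift.tmul, TensorProduct.map_tmul, ← r.eq,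
    TensorProduct.sum_tmul, map_sum, LinearEquiv.coe_coe, h2] at h1
  exact h1

/-- The span of the coefficients of a coaction. -/
noncomputable def coeffs (ρ : V →ₗ[K] H ⊗[K] V) : Submodule K H :=
  Submodule.span K {x | ∃ (f : V →ₗ[K] K) (v : V), sliceR f (ρ v) = x}

lemma sliceR_mem_coeffs (ρ : V →ₗ[K] H ⊗[K] V) (f : V →ₗ[K] K) (v : V) :
    sliceR f (ρ v) ∈ coeffs ρ := Submodule.subset_span ⟨f, v, rfl⟩

lemma sliceL_sliceR_coact {ρ : V →ₗ[K] H ⊗[K] V} (hρ : IsCoaction R ρ) (f : H →ₗ[K] K)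
    (g : V →ₗ[K] K) (v : V) :
    sliceL f (deltaR K H R (sliceR g (ρ v))) = sliceR g (ρ (sliceL f (ρ v))) := by
  rw [← sliceR_rTensor, hρ.coassoc, sliceR_assoc_symm, sliceL_lTensor, sliceL_lTensor]

lemma sliceR_sliceR_coact {ρ : V →ₗ[K] H ⊗[K] V} (hρ : IsCoaction R ρ) (f : H →ₗ[K] K)
    (g : V →ₗ[K] K) (v : V) :
    sliceR f (deltaR K H R (sliceR g (ρ v))) = sliceR (f ∘ₗ sliceR g ∘ₗ ρ) (ρ v) := by
  rw [← sliceR_rTensor, hρ.coassoc, sliceR_assoc_symm, sliceR_lTensor, sliceR_lTensor,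
    LinearMap.comp_assoc]

lemma deltaR_mem_of_mem_coeffs {ρ : V →ₗ[K] H ⊗[K] V} (hρ : IsCoaction R ρ) {x : H}
    (hx : x ∈ coeffs ρ) :
    deltaR K H R x ∈ Submodule.map₂ (TensorProduct.mk K H H) (coeffs ρ) (coeffs ρ) := by
  have hle : coeffs ρ ≤ (Submodule.map₂ (TensorProduct.mk K H H) (coeffs ρ) (coeffs ρ)).comap
      (deltaR K H R) := by
    refine Submodule.span_le.2 ?_
    rintro _ ⟨g, v, rfl⟩
    refine mem_map₂_mk_of_slices (fun f => ?_) fun f => ?_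
    · rw [sliceR_sliceR_coact hρ]
      exact sliceR_mem_coeffs _ _ _
    · rw [sliceL_sliceR_coact hρ]
      exact sliceR_mem_coeffs _ _ _
  exact hle hx

lemma rTensor_ad_coact {τ : H →ₗ[K] H} (hτ : IsSkewAntipode τ) (s : RModStr K H R V) (h : H)
    (v : V) : LinearMap.rTensor V (ad (K := K) h) (s.coact v) = ∑ k ∈ (ℛ K h).index,
      LinearMap.lTensor H (s.act (τ ((ℛ K h).right k))) (s.coact (s.act ((ℛ K h).left k) v)) := by
  let P : H ⊗[K] (H ⊗[K] H) →ₗ[K] H ⊗[K] V :=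
    ((TensorProduct.homTensorHomMap (RingHom.id K) H V H V).flip (s.coact v)) ∘ₗ
      TensorProduct.map (ad (K := K)) (s.act.toLinearMap ∘ₗ LinearMap.mul' K H ∘ₗ
        LinearMap.rTensor H τ ∘ₗ (TensorProduct.comm K H H).toLinearMap)
  have h1 := congrArg P (coassoc_apply (R := K) h)
  have h2 : ∀ z : H ⊗[K] H, P (LinearMap.lTensor H comul z)
      = LinearMap.rTensor V (ad (K := K) (sliceR (counit (R := K)) z)) (s.coact v) := by
    intro z
    induction z with
    | zero => simp
    | add x y hx hy => simp only [map_add, hx, hy, LinearMap.rTensor_add, LinearMap.add_apply]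
    | tmul u w =>
      simp [P, hτ.apply_mul, Module.End.one_eq_id,
        ← LinearMap.rTensor_def]
  have h3 : sliceR (counit (R := K)) (comul (R := K) h) = h := by
    simp [sliceR]
  rw [h2, h3] at h1
  rw [← h1, ← (ℛ K h).eq]
  simp only [map_sum, LinearMap.rTensor_tmul]
  refine Finset.sum_congr rfl fun k _ => ?_
  rw [coact_act s (ℛ K ((ℛ K h).left k)), ← (ℛ K ((ℛ K h).left k)).eq]
  simp only [TensorProduct.sum_tmul, map_sum]
  refine Finset.sum_congr rfl fun l _ => ?_
  rw [← LinearMap.comp_apply (LinearMap.lTensor H _), LinearMap.lTensor_comp_map]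
  simp [P, Module.End.mul_eq_comp]

lemma ad_mem_coeffs {τ : H →ₗ[K] H} (hτ : IsSkewAntipode τ) (s : RModStr K H R V) (h : H) {x : H}
    (hx : x ∈ coeffs s.coact) : ad (K := K) h x ∈ coeffs s.coact := by
  have hle : coeffs s.coact ≤ (coeffs s.coact).comap (ad (K := K) h) := by
    refine Submodule.span_le.2 ?_
    rintro _ ⟨g, v, rfl⟩
    change ad (K := K) h _ ∈ coeffs s.coact
    rw [← sliceR_rTensor, rTensor_ad_coact hτ, map_sum]
    refine sum_mem fun k _ => ?_
    rw [sliceR_lTensor]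
    exact sliceR_mem_coeffs _ _ _
  exact hle hx

lemma coeffs_eq {τ : H →ₗ[K] H} (hτ : IsSkewAntipode τ) (s : RModStr K H R V)
    {D : Submodule K H} (hD : IsMinimalAdjointStableSubcoalgebra K H R D)
    (hs : memDCat K H R D s) (hV : (⊥ : Submodule K V) ≠ ⊤) : coeffs s.coact = D := by
  have hle : coeffs s.coact ≤ D := by
    refine Submodule.span_le.2 ?_
    rintro _ ⟨g, v, rfl⟩
    exact sliceR_mem_of_mem_map₂ (hs v) g
  refine (hD.2.2 _ hle ⟨fun h a ha => ad_mem_coeffs hτ s h ha, fun a ha =>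
    deltaR_mem_of_mem_coeffs s.isCoaction ha⟩).resolve_left fun h0 => hV ?_
  refine Submodule.eq_top_iff'.2 fun v => ?_
  have hv : s.coact v = 0 := eq_of_sliceR_eq fun f => by
    rw [map_zero]
    have := sliceR_mem_coeffs s.coact f v
    rwa [h0, Submodule.mem_bot] at this
  rw [Submodule.mem_bot, ← s.isCoaction.counit v, hv, map_zero]

variable {V' : Type*} [AddCommGroup V'] [Module K V']

lemma exists_colinear [FiniteDimensional K H] (hR : IsQuasiTriangular K H R)
    (hT : R = ∑ i ∈ T, i.1 ⊗ₜ[K] i.2) {φ : H →ₗ[K] K} (hφ1 : φ 1 = 1)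
    (hφR : ∀ x, sliceR φ (comul (R := K) x) = φ x • 1)
    (hφ : ∀ h x, φ (ad (K := K) h x) = counit (R := K) h * φ x)
    {ρ : V →ₗ[K] H ⊗[K] V} {ρ' : V' →ₗ[K] H ⊗[K] V'} (hρ : IsCoaction R ρ)
    (hρ' : IsCoaction R ρ') (hV' : (⊥ : Submodule K V') ≠ ⊤)
    (hmem : ∀ w, ρ' w ∈ Submodule.map₂ (TensorProduct.mk K H V') (coeffs ρ) ⊤) :
    ∃ f : V →ₗ[K] V', f ≠ 0 ∧ ∀ v, ρ' (f v) = LinearMap.lTensor H f (ρ v) := by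
  let F : (V →ₗ[K] K) → V' → V →ₗ[K] V' := fun g w =>
    retraction ρ' T φ ∘ₗ (TensorProduct.mk K H V').flip w ∘ₗ sliceR g ∘ₗ ρ
  have hcol : ∀ g w v, ρ' (F g w v) = LinearMap.lTensor H (F g w) (ρ v) := by
    intro g w v
    have hF : F g w = (retraction ρ' T φ ∘ₗ (TensorProduct.mk K H V').flip w ∘ₗ sliceR g) ∘ₗ ρ :=
      rfl
    have key : ∀ z : H ⊗[K] (H ⊗[K] V), LinearMap.lTensor H (retraction ρ' T φ)
        (TensorProduct.assoc K H H V'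
          (sliceR g ((TensorProduct.assoc K H H V).symm z) ⊗ₜ w))
        = LinearMap.lTensor H
          (retraction ρ' T φ ∘ₗ (TensorProduct.mk K H V').flip w ∘ₗ sliceR g) z := by
      intro z
      induction z with
      | zero => simp
      | add x y hx hy => simp only [map_add, TensorProduct.add_tmul, hx, hy]
      | tmul u y => simp [sliceR_assoc_symm_tmul]
    rw [hF, LinearMap.lTensor_comp, LinearMap.comp_apply (LinearMap.lTensor H _), ← key,
      ← hρ.coassoc, sliceR_rTensor]
    exact coact_retraction hR hT hρ' hφR hφ _
  by_contra! hcon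
  have h0 : ∀ g w, F g w = 0 := fun g w => by
    by_contra hne
    obtain ⟨v, hv⟩ := hcon _ hne
    exact hv (hcol g w v)
  have hker : Submodule.map₂ (TensorProduct.mk K H V') (coeffs ρ) ⊤
      ≤ LinearMap.ker (retraction ρ' T φ) := by
    refine Submodule.map₂_le.2 fun x hx w _ => ?_
    have hle : coeffs ρ ≤ (LinearMap.ker (retraction ρ' T φ)).comap
        ((TensorProduct.mk K H V').flip w) := by
      refine Submodule.span_le.2 ?_
      rintro _ ⟨g, v, rfl⟩
      exact LinearMap.congr_fun (h0 g w) v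
    exact hle hx
  refine hV' (Submodule.eq_top_iff'.2 fun w => ?_)
  rw [Submodule.mem_bot, ← retraction_coact hR hT hρ' hφ1 w]
  exact hker (hmem w)

end HopfAux

namespace HopfAux

open Coalgebra HopfAlgebra

variable {K H} {R : H ⊗[K] H}

lemma sum_cancel_left {μ : H ⊗[K] H →ₗ[K] H}
    (hμ : ∀ h, μ (comul (R := K) h) = counit (R := K) h • 1) {W : Type*} [AddCommGroup W]
    [Module K W] (L : H →ₗ[K] H →ₗ[K] W) (g : H) :
    ∑ k ∈ (ℛ K g).index, ∑ l ∈ (ℛ K ((ℛ K g).right k)).index,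
      L (μ ((ℛ K g).left k ⊗ₜ (ℛ K ((ℛ K g).right k)).left l)) ((ℛ K ((ℛ K g).right k)).right l)
      = L 1 g := by
  let P : H ⊗[K] (H ⊗[K] H) →ₗ[K] W := TensorProduct.lift L ∘ₗ LinearMap.rTensor H μ ∘ₗ
    (TensorProduct.assoc K H H H).symm.toLinearMap
  have h1 := congrArg P (coassoc_apply (R := K) g)
  have h2 : ∀ z : H ⊗[K] H, P (TensorProduct.assoc K H H H (LinearMap.rTensor H comul z))
      = L 1 (sliceL (counit (R := K)) z) := by
    intro z
    induction z with
    | zero => simp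
    | add x y hx hy => simp only [map_add, hx, hy]
    | tmul u w => simp [P, hμ]
  have h3 : sliceL (counit (R := K)) (comul (R := K) g) = g := by simp [sliceL]
  rw [h2, h3, ← (ℛ K g).eq] at h1
  rw [h1, map_sum, map_sum]
  refine Finset.sum_congr rfl fun k _ => ?_
  rw [LinearMap.lTensor_tmul, ← (ℛ K ((ℛ K g).right k)).eq, TensorProduct.tmul_sum, map_sum]
  simp [P]

section TensorObject

variable {X V : Type} [AddCommGroup X] [Module K X] [AddCommGroup V] [Module K V]

/-- The action of `H ⊗ H` on `X ⊗ V`. -/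
noncomputable def actTensor (ξ : H →ₐ[K] Module.End K X) (α : H →ₐ[K] Module.End K V) :
    H ⊗[K] H →ₐ[K] Module.End K (X ⊗[K] V) :=
  Module.endTensorEndAlgHom.comp (Algebra.TensorProduct.map ξ α)

lemma actTensor_tmul (ξ : H →ₐ[K] Module.End K X) (α : H →ₐ[K] Module.End K V) (a b : H) :
    actTensor ξ α (a ⊗ₜ b) = TensorProduct.map (ξ a) (α b) := rfl

/-- The coopposite diagonal action of `H` on `X ⊗ V`, as an algebra homomorphism. -/
noncomputable def actCopHom (ξ : H →ₐ[K] Module.End K X) (α : H →ₐ[K] Module.End K V) :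
    H →ₐ[K] Module.End K (X ⊗[K] V) :=
  (actTensor ξ α).comp ((Algebra.TensorProduct.comm K H H).toAlgHom.comp
    (Bialgebra.comulAlgHom K H))

lemma actCopHom_apply (ξ : H →ₐ[K] Module.End K X) (α : H →ₐ[K] Module.End K V) (h : H) :
    actCopHom ξ α h = actTensor ξ α (TensorProduct.comm K H H (comul (R := K) h)) := rfl

lemma actCopHom_apply_repr (ξ : H →ₐ[K] Module.End K X) (α : H →ₐ[K] Module.End K V) {ι : Type*}
    {h : H} (r : Repr K h ι) : actCopHom ξ α h
      = ∑ k ∈ r.index, TensorProduct.map (ξ (r.right k)) (α (r.left k)) := by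
  rw [actCopHom_apply, ← r.eq]
  simp [actTensor_tmul]

lemma actCopHom_eq_actCop (ξ : H →ₐ[K] Module.End K X) (α : H →ₐ[K] Module.End K V) (h : H) :
    (actCopHom ξ α h : X ⊗[K] V →ₗ[K] X ⊗[K] V) = actCop K H ξ α h := by
  rw [actCopHom_apply_repr ξ α (ℛ K h)]
  ext x v
  simp [actCop, ← (ℛ K h).eq, LinearMap.sum_apply]

lemma coactXV_tmul (ρ : V →ₗ[K] H ⊗[K] V) (x : X) (v : V) :
    coactXV K H ρ (x ⊗ₜ v) = LinearMap.lTensor H (TensorProduct.mk K X V x) (ρ v) := by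
  simp only [coactXV, LinearMap.comp_apply, LinearMap.lTensor_tmul, LinearEquiv.coe_coe]
  induction ρ v with
  | zero => simp
  | add x y hx hy => simp only [map_add, TensorProduct.tmul_add, hx, hy]
  | tmul u v => simp

lemma coactXV_actCopHom (ξ : H →ₐ[K] Module.End K X) (s : RModStr K H R V) (h : H)
    (y : X ⊗[K] V) : coactXV K H s.coact (actCopHom ξ s.act h y) = ∑ k ∈ (ℛ K h).index,
      TensorProduct.map (ad (K := K) ((ℛ K h).left k)) (actCopHom ξ s.act ((ℛ K h).right k))
        (coactXV K H s.coact y) := by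
  induction y with
  | zero => simp
  | add x y hx hy => simp only [map_add, hx, hy, Finset.sum_add_distrib]
  | tmul x v =>
    let P : H ⊗[K] (H ⊗[K] H) →ₗ[K] H ⊗[K] (X ⊗[K] V) :=
      ((TensorProduct.homTensorHomMap (RingHom.id K) H V H (X ⊗[K] V)).flip (s.coact v)) ∘ₗ
        TensorProduct.map (ad (K := K)) (LinearMap.lcomp K _ (TensorProduct.mk K X V x) ∘ₗ
          (actTensor ξ s.act).toLinearMap ∘ₗ (TensorProduct.comm K H H).toLinearMap)
    have h1 := congrArg P (coassoc_apply (R := K) h)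
    have h2 : P (LinearMap.lTensor H comul (comul (R := K) h)) = ∑ k ∈ (ℛ K h).index,
        TensorProduct.map (ad (K := K) ((ℛ K h).left k)) (actCopHom ξ s.act ((ℛ K h).right k))
          (coactXV K H s.coact (x ⊗ₜ v)) := by
      rw [← (ℛ K h).eq, map_sum, map_sum]
      refine Finset.sum_congr rfl fun k _ => ?_
      rw [coactXV_tmul, ← LinearMap.comp_apply (TensorProduct.map _ _),
        LinearMap.map_comp_lTensor, actCopHom_apply]
      simp [P]
      rfl
    have h3 : P (TensorProduct.assoc K H H H (LinearMap.rTensor H comul (comul (R := K) h)))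
        = coactXV K H s.coact (actCopHom ξ s.act h (x ⊗ₜ v)) := by
      rw [actCopHom_apply_repr ξ s.act (ℛ K h), LinearMap.sum_apply, map_sum]
      conv_lhs => rw [← (ℛ K h).eq]
      simp only [map_sum]
      refine Finset.sum_congr rfl fun k _ => ?_
      rw [TensorProduct.map_tmul, coactXV_tmul, coact_act s (ℛ K ((ℛ K h).left k)),
        LinearMap.rTensor_tmul, ← (ℛ K ((ℛ K h).left k)).eq]
      simp only [TensorProduct.sum_tmul, map_sum]
      refine Finset.sum_congr rfl fun l _ => ?_
      rw [← LinearMap.comp_apply (LinearMap.lTensor H _), LinearMap.lTensor_comp_map]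
      simp only [P, LinearMap.comp_apply, LinearMap.flip_apply, TensorProduct.assoc_tmul,
        TensorProduct.map_tmul, LinearEquiv.coe_coe, TensorProduct.comm_tmul,
        TensorProduct.homTensorHomMap_apply]
      rfl
    rw [← h3, h1, h2]

/-- The object `X ⊗ V` with the coopposite diagonal action and the coaction of `V`. -/
noncomputable def tensorModStr (ξ : H →ₐ[K] Module.End K X) (s : RModStr K H R V) :
    RModStr K H R (X ⊗[K] V) where
  act := actCopHom ξ s.act
  coact := coactXV K H s.coact
  counit_coact y := by
    change sliceL (counit (R := K)) (coactXV K H s.coact y) = y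
    induction y with
    | zero => simp
    | add x y hx hy => simp only [map_add, hx, hy]
    | tmul x v => rw [coactXV_tmul, sliceL_lTensor, s.isCoaction.counit, TensorProduct.mk_apply]
  coassocR := by
    refine TensorProduct.ext' fun x v => ?_
    have key : ∀ z : H ⊗[K] (H ⊗[K] V),
        LinearMap.lTensor (H ⊗[K] H) (TensorProduct.mk K X V x)
          ((TensorProduct.assoc K H H V).symm z) = (TensorProduct.assoc K H H (X ⊗[K] V)).symm
          (LinearMap.lTensor H (LinearMap.lTensor H (TensorProduct.mk K X V x)) z) := by
      intro z
      induction z with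
      | zero => simp
      | add x y hx hy => simp only [map_add, hx, hy]
      | tmul u y =>
        induction y with
        | zero => simp
        | add x y hx hy => simp only [map_add, TensorProduct.tmul_add, hx, hy]
        | tmul m n => simp
    have hc : coactXV K H s.coact ∘ₗ TensorProduct.mk K X V x
        = LinearMap.lTensor H (TensorProduct.mk K X V x) ∘ₗ s.coact :=
      LinearMap.ext fun w => coactXV_tmul s.coact x w
    simp only [LinearMap.comp_apply, coactXV_tmul, LinearEquiv.coe_coe]
    rw [← LinearMap.comp_apply (LinearMap.rTensor _ _), LinearMap.rTensor_comp_lTensor,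
      ← LinearMap.lTensor_comp_rTensor, LinearMap.comp_apply, s.isCoaction.coassoc, key,
      ← LinearMap.comp_apply (LinearMap.lTensor H (coactXV K H s.coact)),
      ← LinearMap.lTensor_comp, hc, LinearMap.lTensor_comp, LinearMap.comp_apply]
  compat := by
    refine TensorProduct.ext' fun h y => ?_
    have h2 : ∀ (l m : H) (z : H ⊗[K] (X ⊗[K] V)), TensorProduct.map (adMap K H)
        (TensorProduct.lift (actCopHom ξ s.act).toLinearMap)
        (TensorProduct.tensorTensorTensorComm K H H H (X ⊗[K] V) ((l ⊗ₜ m) ⊗ₜ z))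
        = TensorProduct.map (ad (K := K) l) (actCopHom ξ s.act m) z := by
      intro l m z
      induction z with
      | zero => simp
      | add x y hx hy => simp only [map_add, TensorProduct.tmul_add, hx, hy]
      | tmul u v => simp [adMap_tmul]
    simp only [LinearMap.comp_apply, TensorProduct.lift.tmul, TensorProduct.map_tmul,
      ← (ℛ K h).eq, TensorProduct.sum_tmul, map_sum, LinearEquiv.coe_coe, h2]
    exact coactXV_actCopHom ξ s h y

lemma tensorModStr_memDCat (ξ : H →ₐ[K] Module.End K X) (s : RModStr K H R V) {D : Submodule K H}
    (hs : memDCat K H R D s) : memDCat K H R D (tensorModStr ξ s) := by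
  intro y
  change coactXV K H s.coact y ∈ _
  induction y with
  | zero => simp
  | add x y hx hy => simpa using add_mem hx hy
  | tmul x v =>
    rw [coactXV_tmul]
    refine mem_map₂_mk_of_slices (fun f => ?_) fun _ => Submodule.mem_top
    rw [sliceR_lTensor]
    exact sliceR_mem_of_mem_map₂ (hs v) _

end TensorObject

end HopfAux

namespace HopfAux

open Coalgebra HopfAlgebra

variable {K H} {R : H ⊗[K] H}

section Induced

variable {V V' : Type} [AddCommGroup V] [Module K V] [AddCommGroup V'] [Module K V']
  {τ : H →ₗ[K] H}

lemma IsSkewAntipode.map_one (hτ : IsSkewAntipode τ) : τ 1 = 1 := by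
  simpa [Algebra.TensorProduct.one_def] using hτ.apply_mul 1

/-- The map `a ⊗ b ↦ b ∘ f ∘ τ a`. -/
noncomputable def sandwich (τ : H →ₗ[K] H) (α : H →ₐ[K] Module.End K V)
    (α' : H →ₐ[K] Module.End K V') (f : V →ₗ[K] V') : H ⊗[K] H →ₗ[K] V →ₗ[K] V' :=
  TensorProduct.lift (LinearMap.mk₂ K (fun a b => (α' b : V' →ₗ[K] V') ∘ₗ f ∘ₗ α (τ a))
    (fun _ _ _ => by simp only [map_add, LinearMap.comp_add])
    (fun _ _ _ => by simp only [map_smul, LinearMap.comp_smul])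
    (fun _ _ _ => by simp only [map_add, LinearMap.add_comp])
    (fun _ _ _ => by simp only [map_smul, LinearMap.smul_comp]))

/-- The `H`-linear map `H ⊗ V → V'` extending `f` on `1 ⊗ V`. -/
noncomputable def induced (τ : H →ₗ[K] H) (α : H →ₐ[K] Module.End K V)
    (α' : H →ₐ[K] Module.End K V') (f : V →ₗ[K] V') : H ⊗[K] V →ₗ[K] V' :=
  TensorProduct.lift (sandwich τ α α' f ∘ₗ comul)

lemma induced_tmul (α : H →ₐ[K] Module.End K V) (α' : H →ₐ[K] Module.End K V') (f : V →ₗ[K] V')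
    {ι : Type*} {h : H} (r : Repr K h ι) (v : V) :
    induced τ α α' f (h ⊗ₜ v) = ∑ k ∈ r.index, α' (r.right k) (f (α (τ (r.left k)) v)) := by
  simp [induced, sandwich, ← r.eq, LinearMap.sum_apply]

lemma induced_one_tmul (hτ : IsSkewAntipode τ) (α : H →ₐ[K] Module.End K V)
    (α' : H →ₐ[K] Module.End K V') (f : V →ₗ[K] V') (v : V) :
    induced τ α α' f (1 ⊗ₜ v) = f v := by
  simp [induced, sandwich, Algebra.TensorProduct.one_def, hτ.map_one]

lemma induced_mul_tmul (hτ : IsSkewAntipode τ) (α : H →ₐ[K] Module.End K V)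
    (α' : H →ₐ[K] Module.End K V') (f : V →ₗ[K] V') {ι : Type*} {g : H} (r : Repr K g ι) (h : H)
    (v : V) : induced τ α α' f ((g * h) ⊗ₜ v)
      = ∑ k ∈ r.index, α' (r.right k) (induced τ α α' f (h ⊗ₜ α (τ (r.left k)) v)) := by
  simp only [induced_tmul α α' f (ℛ K h), map_sum]
  simp only [induced, TensorProduct.lift.tmul, LinearMap.comp_apply, Bialgebra.comul_mul]
  rw [← r.eq, ← (ℛ K h).eq, Finset.sum_mul_sum]
  simp [sandwich, hτ.map_mul, LinearMap.sum_apply]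

lemma induced_actCopHom (hτ : IsSkewAntipode τ) (α : H →ₐ[K] Module.End K V)
    (α' : H →ₐ[K] Module.End K V') (f : V →ₗ[K] V') (g : H) (y : H ⊗[K] V) :
    induced τ α α' f (actCopHom (Algebra.lmul K H) α g y) = α' g (induced τ α α' f y) := by
  induction y with
  | zero => simp
  | add x y hx hy => simp only [map_add, hx, hy]
  | tmul h v =>
    let L : H →ₗ[K] H →ₗ[K] V' := LinearMap.mk₂ K
      (fun m c => α' c (induced τ α α' f (h ⊗ₜ α m v)))
      (fun _ _ _ => by simp only [map_add, LinearMap.add_apply, TensorProduct.tmul_add])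
      (fun _ _ _ => by simp only [map_smul, LinearMap.smul_apply, TensorProduct.tmul_smul])
      (fun _ _ _ => by simp only [map_add, LinearMap.add_apply])
      (fun _ _ _ => by simp only [map_smul, LinearMap.smul_apply])
    have hL := sum_cancel_left (μ := LinearMap.mul' K H ∘ₗ LinearMap.rTensor H τ ∘ₗ
      (TensorProduct.comm K H H).toLinearMap) hτ.apply_mul L g
    have h1 : L 1 g = α' g (induced τ α α' f (h ⊗ₜ v)) := by simp [L]
    rw [← h1, ← hL, actCopHom_apply_repr _ α (ℛ K g), LinearMap.sum_apply, map_sum]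
    refine Finset.sum_congr rfl fun k _ => ?_
    rw [TensorProduct.map_tmul, Algebra.coe_lmul_eq_mul, LinearMap.mul_apply',
      induced_mul_tmul hτ α α' f (ℛ K ((ℛ K g).right k))]
    simp [L]

lemma sum_actCopHom_one_tmul (hτ : IsSkewAntipode τ) (α : H →ₐ[K] Module.End K V) (h : H)
    (v : V) : ∑ k ∈ (ℛ K h).index, actCopHom (Algebra.lmul K H) α ((ℛ K h).right k)
      ((1 : H) ⊗ₜ[K] α (τ ((ℛ K h).left k)) v) = h ⊗ₜ v := by
  let L : H →ₗ[K] H →ₗ[K] H ⊗[K] V := LinearMap.mk₂ K (fun m c => c ⊗ₜ α m v)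
    (fun _ _ _ => by simp only [map_add, LinearMap.add_apply, TensorProduct.tmul_add])
    (fun _ _ _ => by simp only [map_smul, LinearMap.smul_apply, TensorProduct.tmul_smul])
    (fun _ _ _ => TensorProduct.add_tmul _ _ _)
    (fun _ _ _ => by simp only [TensorProduct.smul_tmul'])
  have hLa : ∀ m c, L m c = c ⊗ₜ α m v := fun _ _ => rfl
  have hL := sum_cancel_left (μ := LinearMap.mul' K H ∘ₗ LinearMap.lTensor H τ ∘ₗ
    (TensorProduct.comm K H H).toLinearMap) hτ.mul_apply L h
  have h1 : L 1 h = h ⊗ₜ v := by simp [hLa]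
  rw [← h1, ← hL]
  refine Finset.sum_congr rfl fun k _ => ?_
  rw [actCopHom_apply_repr _ α (ℛ K ((ℛ K h).right k)), LinearMap.sum_apply]
  simp [hLa]

lemma induced_colinear (hτ : IsSkewAntipode τ) (s : RModStr K H R V) (s' : RModStr K H R V')
    {f : V →ₗ[K] V'} (hf : ∀ v, s'.coact (f v) = LinearMap.lTensor H f (s.coact v))
    (y : H ⊗[K] V) : LinearMap.lTensor H (induced τ s.act s'.act f) (coactXV K H s.coact y)
      = s'.coact (induced τ s.act s'.act f y) := by
  have hone : induced τ s.act s'.act f ∘ₗ TensorProduct.mk K H V 1 = f :=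
    LinearMap.ext fun v => induced_one_tmul hτ s.act s'.act f v
  have hact : ∀ (h : H) (y : H ⊗[K] V),
      LinearMap.lTensor H (induced τ s.act s'.act f) (coactXV K H s.coact y)
        = s'.coact (induced τ s.act s'.act f y) →
      LinearMap.lTensor H (induced τ s.act s'.act f)
        (coactXV K H s.coact (actCopHom (Algebra.lmul K H) s.act h y))
        = s'.coact (induced τ s.act s'.act f (actCopHom (Algebra.lmul K H) s.act h y)) := by
    intro h y hy
    have hlin : ∀ g, induced τ s.act s'.act f ∘ₗ actCopHom (Algebra.lmul K H) s.act g
        = (s'.act g : V' →ₗ[K] V') ∘ₗ induced τ s.act s'.act f :=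
      fun g => LinearMap.ext fun z => induced_actCopHom hτ s.act s'.act f g z
    rw [coactXV_actCopHom, induced_actCopHom hτ, coact_act s' (ℛ K h), ← hy, map_sum]
    refine Finset.sum_congr rfl fun k _ => ?_
    rw [← LinearMap.comp_apply (LinearMap.lTensor H _), LinearMap.lTensor_comp_map, hlin,
      ← LinearMap.map_comp_lTensor, LinearMap.comp_apply]
  induction y with
  | zero => simp
  | add x y hx hy => simp only [map_add, hx, hy]
  | tmul h v =>
    rw [← sum_actCopHom_one_tmul hτ s.act h v]
    simp only [map_sum]
    refine Finset.sum_congr rfl fun k _ => hact _ _ ?_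
    rw [induced_one_tmul hτ, hf, coactXV_tmul, ← LinearMap.comp_apply (LinearMap.lTensor H _),
      ← LinearMap.lTensor_comp, hone]

end Induced

end HopfAux

/-- **Statement 9.** Let `(H,R)` be a finite dimensional semisimple and cosemisimple
quasi-triangular Hopf algebra and `D` a minimal `H`-adjoint-stable subcoalgebra of
`H_R`.  Then `_H^D M` is an indecomposable module category over `_{H^cop}M` (where
`X ⊗ V` carries the `H`-action `h(x⊗v) = Σ h₍₂₎x ⊗ h₍₁₎v` and the coaction of the
second factor): equivalently (for semisimple module categories), every nonzero object
`V` of `_H^D M` generates, i.e. for every irreducible `V' ∈ _H^D M` there exist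
`X ∈ _{H^cop}M` and a nonzero morphism `X ⊗ V ⟶ V'` in `_H^D M`. -/
theorem DCat_indecomposable
    [FiniteDimensional K H] (R : H ⊗[K] H) (hR : IsQuasiTriangular K H R)
    (hss : IsSemisimpleRing H) (hcoss : IsCosemisimpleCoalgebra K H)
    (D : Submodule K H) (hD : IsMinimalAdjointStableSubcoalgebra K H R D) :
    ∀ (V : Type) [AddCommGroup V] [Module K V] (s : RModStr K H R V),
      memDCat K H R D s → (⊥ : Submodule K V) ≠ ⊤ →
      ∀ (V' : Type) [AddCommGroup V'] [Module K V'] (s' : RModStr K H R V'),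
        memDCat K H R D s' → RModIrreducible K H R s' →
        ∃ (X : Type) (_ : AddCommGroup X) (_ : Module K X)
          (ξ : H →ₐ[K] Module.End K X) (t : RModStr K H R (X ⊗[K] V)),
          memDCat K H R D t ∧
          (∀ h : H, (t.act h : X ⊗[K] V →ₗ[K] X ⊗[K] V) = actCop K H ξ s.act h) ∧
          t.coact = coactXV K H s.coact ∧
          homHD K H R t s' ≠ ⊥ := by
  intro V _ _ s hs hV V' _ _ s' hs' hirr
  obtain ⟨hS, φ, hφ1, hφR, hφ⟩ := HopfAux.exists_adInvariant_integral hss hcoss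
  obtain ⟨τ, hτ⟩ := HopfAux.exists_skewAntipode hS
  obtain ⟨T, hT⟩ := TensorProduct.exists_finset R
  obtain ⟨f, hf0, hf⟩ := HopfAux.exists_colinear hR hT hφ1 hφR hφ s.isCoaction s'.isCoaction
    hirr.1 (fun w => by rw [HopfAux.coeffs_eq hτ s hD hs hV]; exact hs' w)
  refine ⟨H, inferInstance, inferInstance, Algebra.lmul K H, HopfAux.tensorModStr _ s,
    HopfAux.tensorModStr_memDCat _ s hs, fun h => HopfAux.actCopHom_eq_actCop _ _ h, rfl,
    (Submodule.ne_bot_iff _).2 ⟨HopfAux.induced τ s.act s'.act f, ⟨fun h => ?_, ?_⟩, ?_⟩⟩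
  · exact LinearMap.ext fun y => (HopfAux.induced_actCopHom hτ s.act s'.act f h y).symm
  · exact LinearMap.ext fun y => HopfAux.induced_colinear hτ s s' hf y
  · intro h0
    refine hf0 (LinearMap.ext fun v => ?_)
    rw [← HopfAux.induced_one_tmul hτ s.act s'.act f v, h0, LinearMap.zero_apply,
      LinearMap.zero_apply]
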